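/- arXiv:2010.13135 — 7 statements merged into one kernel-verified Lean document; each statement's English description precedes it below -/
import Mathlib

section
/- For an integer g, there exists a lattice polygon with exactly three boundary lattice points, exactly g interior lattice points, and interior lattice points that are not all collinear, if and only if g ≥ 3 and g ∉ {4, 7}. -/
/-- A point of `ℝ × ℝ` is a lattice point if both coordinates are integers. -/
def LatticePt (p : ℝ × ℝ) : Prop := ∃ m n : ℤ, p = ((m : ℝ), (n : ℝ))

/-- The lattice points lying in a subset of the plane. -/
def latticePts (S : Set (ℝ × ℝ)) : Set (ℝ × ℝ) := {p | p ∈ S ∧ LatticePt p}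

/-- Twice the signed area of the triangle `a b p`. -/
def orient (a b p : ℝ × ℝ) : ℝ :=
  (b.1 - a.1) * (p.2 - a.2) - (b.2 - a.2) * (p.1 - a.1)

lemma continuous_orient (a b : ℝ × ℝ) : Continuous (orient a b) := by
  unfold orient; fun_prop

lemma convex_setOf_orient_nonneg (a b : ℝ × ℝ) : Convex ℝ {p | 0 ≤ orient a b p} := by
  intro p hp q hq s t hs ht hst
  simp only [Set.mem_ofPred_eq, orient, Prod.fst_add, Prod.snd_add, Prod.smul_fst, Prod.smul_snd,
    smul_eq_mul] at hp hq ⊢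
  obtain rfl : s = 1 - t := by linarith
  nlinarith [mul_nonneg hs hp, mul_nonneg ht hq]

lemma interior_setOf_orient_nonneg {a b : ℝ × ℝ} (hab : a ≠ b) :
    interior {p | 0 ≤ orient a b p} = {p | 0 < orient a b p} := by
  apply Set.Subset.antisymm
  · intro p hp
    have hp0 : p ∈ {p | 0 ≤ orient a b p} := interior_subset hp
    rw [Set.mem_ofPred_eq] at hp0
    refine lt_of_le_of_ne hp0 fun h0 => hab ?_
    set n : ℝ × ℝ := (b.2 - a.2, -(b.1 - a.1)) with hn
    have hc : Continuous fun t : ℝ => p + t • n := by fun_prop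
    have hev : ∀ᶠ t : ℝ in nhdsWithin 0 (Set.Ioi 0), p + t • n ∈ {p | 0 ≤ orient a b p} := by
      apply nhdsWithin_le_nhds
      have := hc.tendsto 0
      simp only [zero_smul, add_zero] at this
      exact this (mem_interior_iff_mem_nhds.mp hp)
    obtain ⟨t, ht, ht0⟩ := (hev.and self_mem_nhdsWithin).exists
    simp only [Set.mem_ofPred_eq, orient, hn, Prod.fst_add, Prod.snd_add, Prod.smul_fst,
      Prod.smul_snd, smul_eq_mul] at ht ht0 h0
    have hsq : t * ((b.1 - a.1) ^ 2 + (b.2 - a.2) ^ 2) ≤ 0 := by linarith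
    have hsum : (b.1 - a.1) ^ 2 + (b.2 - a.2) ^ 2 ≤ 0 := by
      by_contra! h
      exact absurd hsq (not_le.mpr (mul_pos ht0 h))
    ext <;> nlinarith [sq_nonneg (b.1 - a.1), sq_nonneg (b.2 - a.2)]
  · exact interior_maximal (fun p (hp : 0 < orient a b p) => hp.le)
      (isOpen_lt continuous_const (continuous_orient a b))

lemma convexHull_triangle {a b c : ℝ × ℝ} (h : 0 < orient a b c) :
    convexHull ℝ {a, b, c} =
      {p | 0 ≤ orient a b p} ∩ ({p | 0 ≤ orient b c p} ∩ {p | 0 ≤ orient c a p}) := by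
  apply Set.Subset.antisymm
  · refine convexHull_min ?_ ((convex_setOf_orient_nonneg _ _).inter
      ((convex_setOf_orient_nonneg _ _).inter (convex_setOf_orient_nonneg _ _)))
    rintro p (rfl | rfl | rfl) <;>
      simp only [orient, Set.mem_inter_iff, Set.mem_ofPred_eq] at h ⊢ <;>
      refine ⟨?_, ?_, ?_⟩ <;> nlinarith
  · rintro p ⟨h1, h2, h3⟩
    simp only [Set.mem_ofPred_eq] at h1 h2 h3
    have hs : orient b c p + orient c a p + orient a b p = orient a b c := by
      simp only [orient]; ring
    have hmem : ∀ x ∈ ({a, b, c} : Set (ℝ × ℝ)), x ∈ convexHull ℝ {a, b, c} :=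
      fun x hx => subset_convexHull ℝ _ hx
    have := (convex_convexHull ℝ ({a, b, c} : Set (ℝ × ℝ))).sum_mem
      (t := Finset.univ) (w := ![orient b c p / orient a b c, orient c a p / orient a b c,
        orient a b p / orient a b c]) (z := ![a, b, c]) ?_ ?_ ?_
    · convert this using 1
      simp only [Fin.sum_univ_three, Matrix.cons_val]
      ext <;> simp only [Prod.fst_add, Prod.snd_add, Prod.smul_fst, Prod.smul_snd, smul_eq_mul] <;>
        field_simp <;> simp only [orient] <;> ring
    · intro i _
      fin_cases i <;> simp <;> positivity
    · simp only [Fin.sum_univ_three, Matrix.cons_val]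
      rw [← add_div, ← add_div, hs, div_self h.ne']
    · intro i _
      fin_cases i <;> apply hmem <;> simp

lemma interior_triangle {a b c : ℝ × ℝ} (h : 0 < orient a b c) :
    interior (convexHull ℝ {a, b, c}) =
      {p | 0 < orient a b p} ∩ ({p | 0 < orient b c p} ∩ {p | 0 < orient c a p}) := by
  rw [convexHull_triangle h, interior_inter, interior_inter, interior_setOf_orient_nonneg,
    interior_setOf_orient_nonneg, interior_setOf_orient_nonneg]
  all_goals rintro rfl; simp only [orient] at h; linarith

lemma mem_frontier_triangle {a b c : ℝ × ℝ} (h : 0 < orient a b c) (p : ℝ × ℝ) :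
    p ∈ frontier (convexHull ℝ {a, b, c}) ↔
      (0 ≤ orient a b p ∧ 0 ≤ orient b c p ∧ 0 ≤ orient c a p) ∧
        (orient a b p = 0 ∨ orient b c p = 0 ∨ orient c a p = 0) := by
  have hcl : IsClosed (convexHull ℝ {a, b, c}) :=
    (Set.toFinite ({a, b, c} : Set (ℝ × ℝ))).isClosed_convexHull ℝ
  rw [hcl.frontier_eq, interior_triangle h, convexHull_triangle h]
  simp only [Set.mem_sdiff, Set.mem_inter_iff, Set.mem_ofPred_eq]
  grind

lemma not_collinear_of_orient_ne_zero {s : Set (ℝ × ℝ)} {a b c : ℝ × ℝ} (ha : a ∈ s) (hb : b ∈ s)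
    (hc : c ∈ s) (h : orient a b c ≠ 0) : ¬ Collinear ℝ s := by
  rw [collinear_iff_of_mem ha]
  rintro ⟨v, hv⟩
  obtain ⟨r, rfl⟩ := hv b hb
  obtain ⟨t, rfl⟩ := hv c hc
  apply h
  simp only [orient, vadd_eq_add, Prod.fst_add, Prod.snd_add, Prod.smul_fst, Prod.smul_snd,
    smul_eq_mul]
  ring

lemma collinear_of_orient_eq_zero {s : Set (ℝ × ℝ)} {a b : ℝ × ℝ} (hab : a ≠ b)
    (h : ∀ p ∈ s, orient a b p = 0) : Collinear ℝ s := by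
  rw [collinear_iff_exists_forall_eq_smul_vadd]
  refine ⟨a, b - a, fun p hp => ?_⟩
  have h0 := h p hp
  simp only [orient] at h0
  by_cases h1 : b.1 - a.1 = 0
  · have h2 : b.2 - a.2 ≠ 0 := fun h2 => hab (by ext <;> linarith)
    refine ⟨(p.2 - a.2) / (b.2 - a.2), ?_⟩
    ext <;> simp only [vadd_eq_add, Prod.fst_add, Prod.snd_add, Prod.smul_fst, Prod.smul_snd,
      smul_eq_mul, Prod.fst_sub, Prod.snd_sub] <;> field_simp <;> linarith
  · refine ⟨(p.1 - a.1) / (b.1 - a.1), ?_⟩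
    ext <;> simp only [vadd_eq_add, Prod.fst_add, Prod.snd_add, Prod.smul_fst, Prod.smul_snd,
      smul_eq_mul, Prod.fst_sub, Prod.snd_sub] <;> field_simp <;> linarith

/-- The interior lattice points of the triangle with vertices
`0`, `(1, 0)` and `(k, D)`. -/
def triangleInteriorPts (D k : ℤ) : Set (ℤ × ℤ) :=
  {q | 0 < q.2 ∧ 0 < D * q.1 - k * q.2 ∧ D * q.1 - k * q.2 + q.2 < D}

lemma ncard_triangleInteriorPts {D k : ℤ} (hD : 0 < D) (hk : IsCoprime k D)
    (hk' : IsCoprime (k - 1) D) : 2 * ((triangleInteriorPts D k).ncard : ℤ) + 1 = D := by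
  have hpos : ∀ y ∈ Finset.Ioo 0 D, 0 < (-(k * y)) % D := by
    intro y hy
    rw [Finset.mem_Ioo] at hy
    refine lt_of_le_of_ne (Int.emod_nonneg _ hD.ne') fun h => ?_
    have h1 : D ∣ k * y := (dvd_neg).mp (Int.dvd_of_emod_eq_zero h.symm)
    have h2 := Int.le_of_dvd hy.1 (hk.symm.dvd_of_dvd_mul_left h1)
    omega
  have hne : ∀ y ∈ Finset.Ioo 0 D, y + (-(k * y)) % D ≠ D := by
    intro y hy h
    rw [Finset.mem_Ioo] at hy
    have h0 := Int.mul_ediv_add_emod (-(k * y)) D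
    have h1 : D ∣ (k - 1) * y := ⟨-1 - (-(k * y)) / D, by linarith⟩
    have h2 := Int.le_of_dvd hy.1 (hk'.symm.dvd_of_dvd_mul_left h1)
    omega
  have hrefl : ∀ y ∈ Finset.Ioo 0 D, (-(k * (D - y))) % D = D - (-(k * y)) % D := by
    intro y hy
    have h0 := Int.mul_ediv_add_emod (-(k * y)) D
    have h1 := hpos y hy
    have h2 := Int.emod_lt_of_pos (-(k * y)) hD
    rw [show -(k * (D - y)) = (D - (-(k * y)) % D) + D * (-k - 1 - (-(k * y)) / D) by linarith,
      Int.add_mul_emod_self_left, Int.emod_eq_of_lt (by omega) (by omega)]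
  set F := (Finset.Ioo 0 D).filter fun y => y + (-(k * y)) % D < D with hF
  have hcard : (triangleInteriorPts D k).ncard = F.card := by
    rw [← Set.ncard_coe_finset]
    refine Set.ncard_congr (fun q _ => q.2) ?_ ?_ ?_
    · rintro ⟨x, y⟩ ⟨h1, h2, h3⟩
      simp only at h1 h2 h3
      have : (-(k * y)) % D = D * x - k * y := by
        rw [show -(k * y) = (D * x - k * y) + D * (-x) by ring, Int.add_mul_emod_self_left,
          Int.emod_eq_of_lt h2.le (by omega)]
      simp only [hF, Finset.coe_filter, Finset.mem_Ioo, Set.mem_ofPred_eq]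
      omega
    · rintro ⟨x, y⟩ ⟨x', y'⟩ ⟨h1, h2, h3⟩ ⟨h1', h2', h3'⟩ h
      simp only at h1 h2 h3 h1' h2' h3' h
      subst h
      have : x = x' := by
        by_contra hx
        rcases lt_or_gt_of_ne hx with hx | hx <;> nlinarith
      rw [this]
    · intro y hy
      simp only [hF, Finset.coe_filter, Set.mem_ofPred_eq] at hy
      have h0 := Int.mul_ediv_add_emod (-(k * y)) D
      have h1 := hpos y hy.1
      have h2 := (Finset.mem_Ioo.mp hy.1).1
      have h3 : D * -(-(k * y) / D) - k * y = -(k * y) % D := by linarith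
      refine ⟨(-((-(k * y)) / D), y), ⟨h2, ?_, ?_⟩, rfl⟩
      · simp only; omega
      · simp only; omega
  have hcompl : ((Finset.Ioo 0 D).filter fun y => ¬ y + (-(k * y)) % D < D).card = F.card := by
    refine Finset.card_bij (fun y _ => D - y) ?_ (fun _ _ _ _ h => by omega) ?_
    · intro y hy
      simp only [hF, Finset.mem_filter] at hy ⊢
      have h1 := hrefl y hy.1
      have h2 := hne y hy.1
      have h3 := Finset.mem_Ioo.mp hy.1
      exact ⟨Finset.mem_Ioo.mpr (by omega), by omega⟩
    · intro y hy
      simp only [hF, Finset.mem_filter] at hy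
      have h1 := hrefl y hy.1
      have h3 := Finset.mem_Ioo.mp hy.1
      exact ⟨D - y, Finset.mem_filter.mpr ⟨Finset.mem_Ioo.mpr (by omega), by omega⟩, by omega⟩
  have htot := Finset.card_filter_add_card_filter_not (s := Finset.Ioo 0 D)
    (fun y => y + (-(k * y)) % D < D)
  rw [hcompl, ← hF, Int.card_Ioo] at htot
  rw [hcard]
  omega

/-- The inclusion of `ℤ × ℤ` in `ℝ × ℝ`. -/
def toReal₂ (q : ℤ × ℤ) : ℝ × ℝ := (q.1, q.2)

lemma toReal₂_injective : Function.Injective toReal₂ := by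
  rintro ⟨x, y⟩ ⟨x', y'⟩ h
  simpa [toReal₂] using h

lemma latticePt_iff {p : ℝ × ℝ} : LatticePt p ↔ ∃ q, toReal₂ q = p := by
  simp [LatticePt, toReal₂, eq_comm]

lemma orient_toReal₂ (a b p : ℤ × ℤ) : orient (toReal₂ a) (toReal₂ b) (toReal₂ p) =
    ((b.1 - a.1) * (p.2 - a.2) - (b.2 - a.2) * (p.1 - a.1) : ℤ) := by
  simp [orient, toReal₂]

lemma latticePts_interior_triangle {a u w : ℤ × ℤ} {k D : ℤ} (hD : 0 < D)
    (huw : u.1 * w.2 - u.2 * w.1 = 1) :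
    latticePts (interior (convexHull ℝ
      {toReal₂ a, toReal₂ (a + u), toReal₂ (a + k • u + D • w)})) =
      (fun q : ℤ × ℤ => toReal₂ (a + q.1 • u + q.2 • w)) '' triangleInteriorPts D k := by
  have hpos : 0 < orient (toReal₂ a) (toReal₂ (a + u)) (toReal₂ (a + k • u + D • w)) := by
    rw [orient_toReal₂, Int.cast_pos]
    simp only [Prod.fst_add, Prod.snd_add, Prod.smul_fst, Prod.smul_snd, smul_eq_mul]
    linear_combination hD - D * huw
  have key : ∀ q : ℤ × ℤ, toReal₂ (a + q.1 • u + q.2 • w) ∈ interior (convexHull ℝ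
      {toReal₂ a, toReal₂ (a + u), toReal₂ (a + k • u + D • w)}) ↔
        q ∈ triangleInteriorPts D k := by
    rintro ⟨x, y⟩
    rw [interior_triangle hpos]
    simp only [Set.mem_inter_iff, Set.mem_ofPred_eq, orient_toReal₂, Int.cast_pos,
      triangleInteriorPts, Prod.fst_add, Prod.snd_add, Prod.smul_fst, Prod.smul_snd, smul_eq_mul]
    refine and_congr ?_ ?_
    · refine iff_of_eq (congrArg _ ?_)
      linear_combination y * huw
    · rw [and_comm]
      refine and_congr ?_ ?_
      · refine iff_of_eq (congrArg _ ?_)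
        linear_combination (D * x - k * y) * huw
      · rw [← sub_pos (a := D)]
        refine iff_of_eq (congrArg _ ?_)
        linear_combination (D - (D * x - k * y + y)) * huw
  ext p
  constructor
  · rintro ⟨hp, hl⟩
    obtain ⟨q, rfl⟩ := latticePt_iff.mp hl
    have hq : q = a + (w.2 * (q.1 - a.1) - w.1 * (q.2 - a.2)) • u +
        (u.1 * (q.2 - a.2) - u.2 * (q.1 - a.1)) • w := by
      ext <;> simp only [Prod.fst_add, Prod.snd_add, Prod.smul_fst, Prod.smul_snd, smul_eq_mul]
      · linear_combination (a.1 - q.1) * huw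
      · linear_combination (a.2 - q.2) * huw
    refine ⟨(w.2 * (q.1 - a.1) - w.1 * (q.2 - a.2), u.1 * (q.2 - a.2) - u.2 * (q.1 - a.1)),
      (key _).mp ?_, ?_⟩
    · simp only; rwa [← hq]
    · simp only; rw [← hq]
  · rintro ⟨q, hq, rfl⟩
    exact ⟨(key q).mpr hq, latticePt_iff.mpr ⟨_, rfl⟩⟩

lemma ncard_latticePts_interior_triangle {a u w : ℤ × ℤ} {k D : ℤ} (hD : 0 < D)
    (huw : u.1 * w.2 - u.2 * w.1 = 1) (hk : IsCoprime k D) (hk' : IsCoprime (k - 1) D) :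
    2 * ((latticePts (interior (convexHull ℝ
      {toReal₂ a, toReal₂ (a + u), toReal₂ (a + k • u + D • w)}))).ncard : ℤ) + 1 = D := by
  rw [latticePts_interior_triangle hD huw, Set.ncard_image_of_injective,
    ncard_triangleInteriorPts hD hk hk']
  refine toReal₂_injective.comp ?_
  rintro ⟨x, y⟩ ⟨x', y'⟩ h
  simp only [Prod.ext_iff, Prod.fst_add, Prod.snd_add, Prod.smul_fst, Prod.smul_snd,
    smul_eq_mul] at h ⊢
  constructor
  · linear_combination w.2 * h.1 - w.1 * h.2 - (x - x') * huw
  · linear_combination u.1 * h.2 - u.2 * h.1 - (y - y') * huw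

lemma exists_line_of_nine_or_fifteen {D k : ℤ} (hD : D = 9 ∨ D = 15) (hk : IsCoprime k D)
    (hk' : IsCoprime (k - 1) D) :
    ∃ p d : ℤ × ℤ, ∀ q ∈ triangleInteriorPts D k, ∃ n : ℤ, q = p + n • d := by
  have hmod : ∀ m : ℤ, 1 < m → m ∣ D → k % m ≠ 0 ∧ k % m ≠ 1 := by
    intro m hm hmD
    constructor <;> intro h
    · have := Int.isUnit_iff.mp (hk.isUnit_of_dvd' (Int.dvd_of_emod_eq_zero h) hmD)
      omega
    · have h' : m ∣ k - 1 := by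
        rw [← h]; exact Int.dvd_self_sub_emod
      have := Int.isUnit_iff.mp (hk'.isUnit_of_dvd' h' hmD)
      omega
  obtain ⟨m, hm⟩ : ∃ m, k = D * m + 2 ∨ k = D * m + (D - 1) ∨ 2 * k = D * (2 * m) + (D + 1) := by
    refine ⟨k / D, ?_⟩
    rcases hD with rfl | rfl
    · have h3 := hmod 3 (by norm_num) (by norm_num)
      omega
    · have h3 := hmod 3 (by norm_num) (by norm_num)
      have h5 := hmod 5 (by norm_num) (by norm_num)
      omega
  rcases hm with hm | hm | hm
  · refine ⟨(1, 0), (m, 1), ?_⟩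
    rintro ⟨x, y⟩ ⟨h1, h2, h3⟩
    simp only at h1 h2 h3
    have hz : x - m * y = 1 := by
      have h4 : D * x - k * y = D * (x - m * y) - 2 * y := by rw [hm]; ring
      rw [h4] at h2 h3
      rcases hD with rfl | rfl <;> omega
    exact ⟨y, by ext <;> simp; linarith⟩
  · refine ⟨(0, 0), (m + 1, 1), ?_⟩
    rintro ⟨x, y⟩ ⟨h1, h2, h3⟩
    simp only at h1 h2 h3
    have hz : x - m * y = y := by
      have h4 : D * x - k * y = D * (x - m * y) - (D - 1) * y := by rw [hm]; ring
      rw [h4] at h2 h3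
      rcases hD with rfl | rfl <;> omega
    exact ⟨y, by ext <;> simp; linarith⟩
  · refine ⟨(-m, -1), (1 + 2 * m, 2), ?_⟩
    rintro ⟨x, y⟩ ⟨h1, h2, h3⟩
    simp only at h1 h2 h3
    have hz : 2 * (x - m * y) = y + 1 := by
      have h4 : 2 * (D * x - k * y) = 2 * D * (x - m * y) - (D + 1) * y := by
        linear_combination (-y) * hm
      rcases hD with rfl | rfl <;> omega
    refine ⟨x - m * y, ?_⟩
    ext <;> simp
    · linear_combination (-m) * hz
    · linear_combination -hz

lemma isCoprime_edge_of_frontier_subset {a b c : ℤ × ℤ}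
    (h : 0 < orient (toReal₂ a) (toReal₂ b) (toReal₂ c))
    (hF : latticePts (frontier (convexHull ℝ {toReal₂ a, toReal₂ b, toReal₂ c})) ⊆
      {toReal₂ a, toReal₂ b, toReal₂ c}) :
    IsCoprime (b.1 - a.1) (b.2 - a.2) := by
  have h' := h
  rw [orient_toReal₂, Int.cast_pos] at h'
  obtain ⟨e₁, he₁⟩ := Int.gcd_dvd_left (b.1 - a.1) (b.2 - a.2)
  obtain ⟨e₂, he₂⟩ := Int.gcd_dvd_right (b.1 - a.1) (b.2 - a.2)
  rw [Int.isCoprime_iff_gcd_eq_one]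
  set d := Int.gcd (b.1 - a.1) (b.2 - a.2)
  rw [he₁, he₂] at h'
  by_contra hd
  have hd0 : d ≠ 0 := by
    intro h0
    simp [h0] at h'
  have hd2 : (2 : ℤ) ≤ d := by omega
  have hE : 0 < e₁ * (c.2 - a.2) - e₂ * (c.1 - a.1) := by
    by_contra! hE
    nlinarith
  have hmem : toReal₂ (a + (e₁, e₂)) ∈
      latticePts (frontier (convexHull ℝ {toReal₂ a, toReal₂ b, toReal₂ c})) := by
    refine ⟨?_, latticePt_iff.mpr ⟨_, rfl⟩⟩
    rw [mem_frontier_triangle h]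
    simp only [orient_toReal₂, Int.cast_nonneg_iff, Int.cast_eq_zero, Prod.fst_add, Prod.snd_add]
    refine ⟨⟨le_of_eq ?_, ?_, ?_⟩, Or.inl ?_⟩
    · rw [he₁, he₂]; ring
    · have : (c.1 - b.1) * (a.2 + e₂ - b.2) - (c.2 - b.2) * (a.1 + e₁ - b.1) =
          (d - 1) * (e₁ * (c.2 - a.2) - e₂ * (c.1 - a.1)) := by
        rw [show b.1 = a.1 + d * e₁ by linarith, show b.2 = a.2 + d * e₂ by linarith]
        ring
      rw [this]
      exact mul_nonneg (by linarith) hE.le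
    · linarith
    · rw [he₁, he₂]; ring
  rcases hF hmem with hq | hq | hq
  all_goals
    have hq' := toReal₂_injective hq
    simp only [Prod.ext_iff, Prod.fst_add, Prod.snd_add] at hq'
  · rw [show e₁ = 0 by linarith, show e₂ = 0 by linarith] at hE
    simp at hE
  · have h1 : ((d : ℤ) - 1) * e₁ = 0 := by linarith
    have h2 : ((d : ℤ) - 1) * e₂ = 0 := by linarith
    rw [(mul_eq_zero.mp h1).resolve_left (by omega),
      (mul_eq_zero.mp h2).resolve_left (by omega)] at hE
    simp at hE
  · rw [← hq'.1, ← hq'.2] at hE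
    ring_nf at hE
    exact lt_irrefl _ hE

/-- A triangle all of whose edges are primitive is, up to an affine unimodular change of
coordinates, the triangle with vertices `0`, `(1, 0)` and `(k, D)`. -/
lemma exists_normal_form {a b c : ℤ × ℤ}
    (h : 0 < orient (toReal₂ a) (toReal₂ b) (toReal₂ c))
    (hF : latticePts (frontier (convexHull ℝ {toReal₂ a, toReal₂ b, toReal₂ c})) ⊆
      {toReal₂ a, toReal₂ b, toReal₂ c}) :
    ∃ (u w : ℤ × ℤ) (k D : ℤ), 0 < D ∧ u.1 * w.2 - u.2 * w.1 = 1 ∧ IsCoprime k D ∧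
      IsCoprime (k - 1) D ∧ b = a + u ∧ c = a + k • u + D • w := by
  have hab := isCoprime_edge_of_frontier_subset h hF
  have hbc : IsCoprime (c.1 - b.1) (c.2 - b.2) := by
    refine isCoprime_edge_of_frontier_subset (c := a) ?_ ?_
    · convert h using 1
      simp only [orient]; ring
    · have : ({toReal₂ b, toReal₂ c, toReal₂ a} : Set (ℝ × ℝ)) =
        {toReal₂ a, toReal₂ b, toReal₂ c} := by grind
      rwa [this]
  have hca : IsCoprime (a.1 - c.1) (a.2 - c.2) := by
    refine isCoprime_edge_of_frontier_subset (c := b) ?_ ?_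
    · convert h using 1
      simp only [orient]; ring
    · have : ({toReal₂ c, toReal₂ a, toReal₂ b} : Set (ℝ × ℝ)) =
        {toReal₂ a, toReal₂ b, toReal₂ c} := by grind
      rwa [this]
  rw [orient_toReal₂, Int.cast_pos] at h
  obtain ⟨α, β, hαβ⟩ := hab
  set D := (b.1 - a.1) * (c.2 - a.2) - (b.2 - a.2) * (c.1 - a.1) with hD
  set k := α * (c.1 - a.1) + β * (c.2 - a.2) with hk
  have h1 : c.1 - a.1 = k * (b.1 - a.1) + D * -β := by
    rw [hk, hD]; linear_combination (-(c.1 - a.1)) * hαβ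
  have h2 : c.2 - a.2 = k * (b.2 - a.2) + D * α := by
    rw [hk, hD]; linear_combination (-(c.2 - a.2)) * hαβ
  refine ⟨b - a, (-β, α), k, D, h, ?_, ?_, ?_, by abel, ?_⟩
  · simp only [Prod.fst_sub, Prod.snd_sub]; linarith
  · obtain ⟨x, y, hxy⟩ := hca
    exact ⟨-(x * (b.1 - a.1) + y * (b.2 - a.2)), x * β - y * α,
      by linear_combination hxy + x * h1 + y * h2⟩
  · obtain ⟨x, y, hxy⟩ := hbc
    exact ⟨x * (b.1 - a.1) + y * (b.2 - a.2), -x * β + y * α,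
      by linear_combination hxy - x * h1 - y * h2⟩
  · ext <;> simp only [Prod.fst_add, Prod.snd_add, Prod.smul_fst, Prod.smul_snd, smul_eq_mul,
      Prod.fst_sub, Prod.snd_sub] <;> linarith

/-- A polygon with exactly three boundary lattice points is the triangle spanned by them. -/
lemma exists_triangle_of_ncard_frontier_eq_three {V : Finset (ℝ × ℝ)}
    (hV : ∀ p ∈ V, LatticePt p) (hcol : ¬ Collinear ℝ (V : Set (ℝ × ℝ)))
    (h3 : (latticePts (frontier (convexHull ℝ (V : Set (ℝ × ℝ))))).ncard = 3) :
    ∃ a b c : ℤ × ℤ, 0 < orient (toReal₂ a) (toReal₂ b) (toReal₂ c) ∧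
      convexHull ℝ (V : Set (ℝ × ℝ)) = convexHull ℝ {toReal₂ a, toReal₂ b, toReal₂ c} ∧
      latticePts (frontier (convexHull ℝ {toReal₂ a, toReal₂ b, toReal₂ c})) ⊆
        {toReal₂ a, toReal₂ b, toReal₂ c} := by
  set P := convexHull ℝ (V : Set (ℝ × ℝ)) with hP
  have hcomp : IsCompact P := V.finite_toSet.isCompact_convexHull ℝ
  have hext : P.extremePoints ℝ ⊆ latticePts (frontier P) := by
    intro p hp
    refine ⟨⟨subset_closure hp.1, fun hi => ?_⟩, hV p (extremePoints_convexHull_subset hp)⟩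
    exact (disjoint_interior_extremePoints P).le_bot ⟨hi, hp⟩
  have hfin : (P.extremePoints ℝ).Finite :=
    V.finite_toSet.subset extremePoints_convexHull_subset
  have hKM : convexHull ℝ (P.extremePoints ℝ) = P := by
    rw [← (hfin.isClosed_convexHull ℝ).closure_eq]
    exact closure_convexHull_extremePoints hcomp (convex_convexHull ℝ _)
  have hhull : P = convexHull ℝ (latticePts (frontier P)) := by
    apply Set.Subset.antisymm
    · exact hKM.symm.subset.trans (convexHull_mono hext)
    · exact convexHull_min (fun p hp => hcomp.isClosed.frontier_subset hp.1)
        (convex_convexHull ℝ _)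
  obtain ⟨x, y, z, hxy, -, -, hset⟩ := Set.ncard_eq_three.mp h3
  have hlat : ∀ p ∈ ({x, y, z} : Set (ℝ × ℝ)), LatticePt p := by
    rw [← hset]; exact fun p hp => hp.2
  obtain ⟨a, rfl⟩ := latticePt_iff.mp (hlat x (by simp))
  obtain ⟨b, rfl⟩ := latticePt_iff.mp (hlat y (by simp))
  obtain ⟨c, rfl⟩ := latticePt_iff.mp (hlat z (by simp))
  rw [hset] at hhull
  rcases lt_trichotomy (orient (toReal₂ a) (toReal₂ b) (toReal₂ c)) 0 with h | h | h
  · have hswap : ({toReal₂ a, toReal₂ c, toReal₂ b} : Set (ℝ × ℝ)) =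
        {toReal₂ a, toReal₂ b, toReal₂ c} := by grind
    refine ⟨a, c, b, ?_, ?_, ?_⟩
    · simp only [orient] at h ⊢; linarith
    · rw [hswap]; exact hhull
    · rw [hswap, ← hhull, hset]
  · refine absurd (collinear_of_orient_eq_zero hxy fun p hp => ?_) hcol
    have hp' : p ∈ convexHull ℝ {toReal₂ a, toReal₂ b, toReal₂ c} :=
      hhull ▸ subset_convexHull ℝ _ hp
    have hle := convexHull_min (t := {p | 0 ≤ orient (toReal₂ a) (toReal₂ b) p}) (by
      rintro q (rfl | rfl | rfl)
      · simp [orient]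
      · simp [orient, mul_comm]
      · exact h.ge) (convex_setOf_orient_nonneg _ _) hp'
    have hge := convexHull_min (t := {p | 0 ≤ orient (toReal₂ b) (toReal₂ a) p}) (by
      rintro q (rfl | rfl | rfl)
      · simp [orient, mul_comm]
      · simp [orient]
      · simp only [Set.mem_ofPred_eq, orient] at h ⊢
        linarith) (convex_setOf_orient_nonneg _ _) hp'
    simp only [Set.mem_ofPred_eq, orient] at hle hge ⊢
    linarith
  · exact ⟨a, b, c, h, hhull, by rw [← hhull, hset]⟩

lemma exists_nonhyperelliptic_parameter {g : ℤ} (h3 : 3 ≤ g) (h4 : g ≠ 4) (h7 : g ≠ 7) :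
    ∃ k : ℤ, IsCoprime k (2 * g + 1) ∧ IsCoprime (k - 1) (2 * g + 1) ∧
      ∃ p q r, p ∈ triangleInteriorPts (2 * g + 1) k ∧ q ∈ triangleInteriorPts (2 * g + 1) k ∧
        r ∈ triangleInteriorPts (2 * g + 1) k ∧
        (q.1 - p.1) * (r.2 - p.2) - (q.2 - p.2) * (r.1 - p.1) ≠ 0 := by
  have hcop3 : ∀ n : ℤ, n % 3 ≠ 0 → IsCoprime n 3 := fun n hn =>
    ((Int.prime_three.coprime_iff_not_dvd).mpr (by omega)).symm
  have hcop2 : ∀ n : ℤ, n % 2 = 1 → IsCoprime n 2 := fun n hn =>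
    ((Int.prime_two.coprime_iff_not_dvd).mpr (by omega)).symm
  by_cases hg3 : (2 * g + 1) % 3 = 0
  · by_cases hg9 : (2 * g + 1) % 9 = 0
    · obtain ⟨c, hc⟩ : ∃ c, 2 * g + 1 = 9 * c := ⟨(2 * g + 1) / 9, by omega⟩
      obtain ⟨x, y, hxy⟩ := hcop2 c (by omega)
      rw [hc]
      refine ⟨3 * c + 2, ?_, ?_, (1, 1), (1, 2), (2, 4), ?_, ?_, ?_, by norm_num⟩
      · rw [show 9 * c = 3 * 3 * c by ring]
        exact (((hcop3 _ (by omega)).mul_right (hcop3 _ (by omega)))).mul_right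
          ⟨y, x - 3 * y, by linear_combination hxy⟩
      · rw [show 9 * c = 3 * 3 * c by ring]
        exact (((hcop3 _ (by omega)).mul_right (hcop3 _ (by omega)))).mul_right
          ⟨1, -3, by ring⟩
      all_goals refine ⟨?_, ?_, ?_⟩ <;> simp only <;> omega
    · obtain ⟨B, hB⟩ : ∃ B, 2 * g + 1 = 3 * B := ⟨(2 * g + 1) / 3, by omega⟩
      obtain ⟨x, y, hxy⟩ := hcop2 B (by omega)
      obtain ⟨x', y', hxy'⟩ := hcop3 B (by omega)
      rw [hB]
      by_cases hB3 : B % 3 = 2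
      · refine ⟨B + 3, ?_, ?_, (1, 1), (1, 2), (2, 4), ?_, ?_, ?_, by norm_num⟩
        · exact (hcop3 _ (by omega)).mul_right ⟨y', x' - y', by linear_combination hxy'⟩
        · exact (hcop3 _ (by omega)).mul_right ⟨y, x - y, by linear_combination hxy⟩
        all_goals refine ⟨?_, ?_, ?_⟩ <;> simp only <;> omega
      · refine ⟨2 * B + 3, ?_, ?_, (1, 1), (2, 2), (5, 6), ?_, ?_, ?_, by norm_num⟩
        · exact (hcop3 _ (by omega)).mul_right ⟨y', x' - 2 * y', by linear_combination hxy'⟩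
        · exact (hcop3 _ (by omega)).mul_right ⟨y, x - 2 * y, by linear_combination hxy⟩
        all_goals refine ⟨?_, ?_, ?_⟩ <;> simp only <;> omega
  · refine ⟨3, (hcop3 _ hg3).symm, (hcop2 _ (by omega)).symm, (1, 1), (1, 2), (2, g + 1),
      ?_, ?_, ?_, by norm_num⟩
    all_goals refine ⟨?_, ?_, ?_⟩ <;> simp only <;> omega

lemma latticePts_frontier_triangle {k D : ℤ} (hD : 0 < D) (hk : IsCoprime k D)
    (hk' : IsCoprime (k - 1) D) :
    latticePts (frontier (convexHull ℝ {toReal₂ (0, 0), toReal₂ (1, 0), toReal₂ (k, D)})) =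
      {toReal₂ (0, 0), toReal₂ (1, 0), toReal₂ (k, D)} := by
  have hpos : 0 < orient (toReal₂ (0, 0)) (toReal₂ (1, 0)) (toReal₂ (k, D)) := by
    simpa [orient, toReal₂] using hD
  ext p
  constructor
  · rintro ⟨hp, hl⟩
    obtain ⟨⟨x, y⟩, rfl⟩ := latticePt_iff.mp hl
    rw [mem_frontier_triangle hpos] at hp
    simp only [orient_toReal₂, Int.cast_nonneg_iff, Int.cast_eq_zero] at hp
    simp only [Set.mem_insert_iff, Set.mem_singleton_iff, toReal₂_injective.eq_iff, Prod.mk.injEq]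
    obtain ⟨⟨h1, h2, h3⟩, h | h | h⟩ := hp
    · obtain rfl : y = 0 := by linarith
      have : 0 ≤ x := by by_contra! hx; nlinarith
      have : x ≤ 1 := by by_contra! hx; nlinarith
      omega
    · obtain ⟨m, rfl⟩ : D ∣ y := hk'.symm.dvd_of_dvd_mul_left ⟨x - 1, by linarith⟩
      have hx : x - 1 = m * (k - 1) := mul_left_cancel₀ hD.ne' (by linarith)
      have : 0 ≤ m := by by_contra! hx; nlinarith
      have : m ≤ 1 := by by_contra! hx; nlinarith
      obtain rfl | rfl : m = 0 ∨ m = 1 := by omega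
      · right; left; constructor <;> linarith
      · right; right; constructor <;> linarith
    · obtain ⟨m, rfl⟩ : D ∣ y := hk.symm.dvd_of_dvd_mul_left ⟨x, by linarith⟩
      have hx : x = m * k := mul_left_cancel₀ hD.ne' (by linarith)
      have : 0 ≤ m := by by_contra! hx; nlinarith
      have : m ≤ 1 := by by_contra! hx; nlinarith
      obtain rfl | rfl : m = 0 ∨ m = 1 := by omega
      · left; constructor <;> linarith
      · right; right; constructor <;> linarith
  · intro hp
    refine ⟨?_, ?_⟩
    · rw [mem_frontier_triangle hpos]
      rcases hp with rfl | rfl | rfl <;>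
        simp only [orient_toReal₂, Int.cast_nonneg_iff, Int.cast_eq_zero] <;>
        ring_nf <;> simp [hD.le]
    · rcases hp with rfl | rfl | rfl <;> exact latticePt_iff.mpr ⟨_, rfl⟩

lemma three_le_ncard_of_not_collinear {s : Set (ℝ × ℝ)} (hs : s.Finite)
    (h : ¬ Collinear ℝ s) : 3 ≤ s.ncard := by
  by_contra! hlt
  interval_cases hn : s.ncard
  · rw [(Set.ncard_eq_zero hs).mp hn] at h
    exact h (collinear_empty ℝ _)
  · obtain ⟨x, rfl⟩ := Set.ncard_eq_one.mp hn
    exact h (collinear_singleton ℝ x)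
  · obtain ⟨x, y, -, rfl⟩ := Set.ncard_eq_two.mp hn
    exact h (collinear_pair ℝ x y)

lemma finite_triangleInteriorPts {D k : ℤ} (hD : 0 < D) (hk : IsCoprime k D)
    (hk' : IsCoprime (k - 1) D) (hD1 : D ≠ 1) : (triangleInteriorPts D k).Finite := by
  refine Set.finite_of_ncard_ne_zero fun h => ?_
  have := ncard_triangleInteriorPts hD hk hk'
  omega

/-- There exists a lattice polygon (a two-dimensional convex hull of finitely many
lattice points) with exactly three boundary lattice points, exactly `g` interior
lattice points, and non-collinear interior lattice points, if and only if
`g ≥ 3` and `g ∉ {4, 7}`. -/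
theorem stmt0 (g : ℤ) :
    (∃ (V : Finset (ℝ × ℝ)) (P : Set (ℝ × ℝ)),
      (∀ p ∈ V, LatticePt p) ∧
      ¬ Collinear ℝ (V : Set (ℝ × ℝ)) ∧
      P = convexHull ℝ (V : Set (ℝ × ℝ)) ∧
      (latticePts (frontier P)).ncard = 3 ∧
      ((latticePts (interior P)).ncard : ℤ) = g ∧
      ¬ Collinear ℝ (latticePts (interior P))) ↔
    (3 ≤ g ∧ g ≠ 4 ∧ g ≠ 7) := by
  constructor
  · rintro ⟨V, P, hV, hcol, rfl, h3, hg, hint⟩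
    obtain ⟨a, b, c, hpos, hhull, hF⟩ := exists_triangle_of_ncard_frontier_eq_three hV hcol h3
    obtain ⟨u, w, k, D, hD, huw, hk, hk', rfl, rfl⟩ := exists_normal_form hpos hF
    have hcard := ncard_latticePts_interior_triangle (a := a) hD huw hk hk'
    rw [← hhull, hg] at hcard
    rw [hhull, latticePts_interior_triangle hD huw] at hint
    have hne : ¬ (D = 9 ∨ D = 15) := by
      intro h
      obtain ⟨p, d, hline⟩ := exists_line_of_nine_or_fifteen h hk hk'
      refine hint ((collinear_iff_exists_forall_eq_smul_vadd _).mpr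
        ⟨toReal₂ (a + p.1 • u + p.2 • w), toReal₂ (d.1 • u + d.2 • w), ?_⟩)
      rintro _ ⟨q, hq, rfl⟩
      obtain ⟨n, rfl⟩ := hline q hq
      refine ⟨n, ?_⟩
      ext <;> simp [toReal₂] <;> ring
    have hD1 : D ≠ 1 := by
      rintro rfl
      refine hint ?_
      have hempty : triangleInteriorPts 1 k = ∅ := by
        ext q
        simp only [triangleInteriorPts, Set.mem_ofPred_eq, Set.mem_empty_iff_false, iff_false]
        omega
      rw [hempty, Set.image_empty]
      exact collinear_empty ℝ _
    have h3g := three_le_ncard_of_not_collinear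
      ((finite_triangleInteriorPts hD hk hk' hD1).image _) hint
    rw [← latticePts_interior_triangle hD huw, ← hhull] at h3g
    omega
  · rintro ⟨h3, h4, h7⟩
    obtain ⟨k, hk, hk', p, q, r, hp, hq, hr, hpqr⟩ := exists_nonhyperelliptic_parameter h3 h4 h7
    have hD : 0 < 2 * g + 1 := by omega
    set D := 2 * g + 1 with hDg
    have hunit : ((1, 0) : ℤ × ℤ).1 * ((0, 1) : ℤ × ℤ).2 -
      ((1, 0) : ℤ × ℤ).2 * ((0, 1) : ℤ × ℤ).1 = 1 := by norm_num
    have hcard := ncard_latticePts_interior_triangle (a := (0, 0)) hD hunit hk hk'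
    have hint := latticePts_interior_triangle (a := (0, 0)) (k := k) hD hunit
    simp only [Prod.smul_mk, smul_eq_mul, Prod.mk_add_mk, mul_one, mul_zero, add_zero,
      zero_add, Prod.mk.eta] at hcard hint
    have hcoe : (({toReal₂ (0, 0), toReal₂ (1, 0), toReal₂ (k, D)} : Finset (ℝ × ℝ)) :
        Set (ℝ × ℝ)) = {toReal₂ (0, 0), toReal₂ (1, 0), toReal₂ (k, D)} := by simp
    refine ⟨{toReal₂ (0, 0), toReal₂ (1, 0), toReal₂ (k, D)}, _, ?_, ?_, rfl, ?_, ?_, ?_⟩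
    · intro p hp
      simp only [Finset.mem_insert, Finset.mem_singleton] at hp
      rcases hp with rfl | rfl | rfl <;> exact latticePt_iff.mpr ⟨_, rfl⟩
    · rw [hcoe]
      refine not_collinear_of_orient_ne_zero (a := toReal₂ (0, 0)) (b := toReal₂ (1, 0))
        (c := toReal₂ (k, D)) (by simp) (by simp) (by simp) ?_
      rw [orient_toReal₂, Int.cast_ne_zero]
      simpa using hD.ne'
    · rw [hcoe, latticePts_frontier_triangle hD hk hk', Set.ncard_eq_three]
      refine ⟨_, _, _, ?_, ?_, ?_, rfl⟩ <;>
        simp [toReal₂_injective.eq_iff, hD.ne]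
    · rw [hcoe]; omega
    · rw [hcoe, hint]
      refine not_collinear_of_orient_ne_zero ⟨p, hp, rfl⟩ ⟨q, hq, rfl⟩ ⟨r, hr, rfl⟩ ?_
      rw [orient_toReal₂, Int.cast_ne_zero]
      exact hpqr
end

section
/- For every integer k ≥ 1, the triangle with vertices (1,0), (0,3), and (2k+1,1) has exactly three boundary lattice points (namely its vertices), has exactly 3k interior lattice points, and contains (1,1), (1,2), and (2,1) among its interior lattice points; in particular its interior lattice points are not all collinear. -/
/-- The triangle with vertices `(1,0)`, `(0,3)`, `(2k+1,1)` as an intersection of half-planes. -/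
theorem convexHull_triangle_eq (k : ℝ) (hk : 1 ≤ k) :
    convexHull ℝ ({((1:ℝ), (0:ℝ)), ((0:ℝ), (3:ℝ)), (2*k+1, (1:ℝ))} : Set (ℝ × ℝ)) =
      {p | 0 ≤ 6*k+3 - 2*p.1 - (2*k+1)*p.2 ∧ 0 ≤ 2*k*p.2 - p.1 + 1 ∧ 0 ≤ 3*p.1 + p.2 - 3} := by
  apply Set.Subset.antisymm
  · apply convexHull_min
    · rintro p (rfl | rfl | rfl) <;> refine ⟨?_, ?_, ?_⟩ <;> dsimp only <;> linarith
    · rintro ⟨x, y⟩ ⟨h1, h2, h3⟩ ⟨u, v⟩ ⟨g1, g2, g3⟩ a b ha hb hab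
      dsimp only at *
      obtain rfl : b = 1 - a := by linarith
      refine ⟨?_, ?_, ?_⟩ <;> simp only [Prod.fst_add, Prod.snd_add, Prod.smul_mk, smul_eq_mul]
      · linarith [mul_nonneg ha h1, mul_nonneg hb g1]
      · linarith [mul_nonneg ha h2, mul_nonneg hb g2]
      · linarith [mul_nonneg ha h3, mul_nonneg hb g3]
  · rintro ⟨x, y⟩ ⟨h1, h2, h3⟩
    dsimp only at h1 h2 h3
    have hN : 0 < 6*k+1 := by linarith
    refine mem_convexHull_of_exists_fintype
      (ι := Fin 3) ![(6*k+3 - 2*x - (2*k+1)*y)/(6*k+1), (2*k*y - x + 1)/(6*k+1),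
        (3*x + y - 3)/(6*k+1)] ![(1, 0), (0, 3), (2*k+1, 1)] ?_ ?_ ?_ ?_
    · intro i
      fin_cases i
      · exact div_nonneg h1 hN.le
      · exact div_nonneg h2 hN.le
      · exact div_nonneg h3 hN.le
    · simp only [Fin.sum_univ_three, Matrix.cons_val]
      field_simp
      ring
    · intro i
      fin_cases i <;> simp
    · simp only [Fin.sum_univ_three, Matrix.cons_val, Prod.smul_mk, smul_eq_mul, Prod.mk_add_mk,
        Prod.mk.injEq]
      constructor <;> field_simp <;> ring

theorem isClosed_triangle (k : ℝ) :
    IsClosed {p : ℝ × ℝ | 0 ≤ 6*k+3 - 2*p.1 - (2*k+1)*p.2 ∧ 0 ≤ 2*k*p.2 - p.1 + 1 ∧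
      0 ≤ 3*p.1 + p.2 - 3} := by
  simp only [Set.ofPred_and]
  exact (isClosed_le (by fun_prop) (by fun_prop)).inter
    ((isClosed_le (by fun_prop) (by fun_prop)).inter (isClosed_le (by fun_prop) (by fun_prop)))

theorem interior_triangle_s1 (k : ℝ) :
    interior {p : ℝ × ℝ | 0 ≤ 6*k+3 - 2*p.1 - (2*k+1)*p.2 ∧ 0 ≤ 2*k*p.2 - p.1 + 1 ∧
      0 ≤ 3*p.1 + p.2 - 3} =
      {p | 0 < 6*k+3 - 2*p.1 - (2*k+1)*p.2 ∧ 0 < 2*k*p.2 - p.1 + 1 ∧ 0 < 3*p.1 + p.2 - 3} := by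
  apply Set.Subset.antisymm
  · rintro ⟨x, y⟩ h
    obtain ⟨ε, hε, hball⟩ := Metric.mem_nhds_iff.1 (mem_interior_iff_mem_nhds.1 h)
    have hmem : ∀ t : ℝ, |t| < ε → (x + t, y) ∈ Metric.ball (x, y) ε := by
      intro t ht
      simpa [Metric.mem_ball, Prod.dist_eq, Real.dist_eq, hε] using ht
    have hr := hball (hmem (ε/2) (by rw [abs_of_pos] <;> linarith))
    have hl := hball (hmem (-(ε/2)) (by rw [abs_neg, abs_of_pos] <;> linarith))
    obtain ⟨h1, h2, -⟩ := hr
    obtain ⟨-, -, h3⟩ := hl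
    dsimp only at h1 h2 h3
    refine ⟨?_, ?_, ?_⟩ <;> dsimp only <;> linarith
  · apply interior_maximal
    · rintro p ⟨h1, h2, h3⟩
      exact ⟨h1.le, h2.le, h3.le⟩
    · simp only [Set.ofPred_and]
      exact (isOpen_lt (by fun_prop) (by fun_prop)).inter
        ((isOpen_lt (by fun_prop) (by fun_prop)).inter (isOpen_lt (by fun_prop) (by fun_prop)))

/-- The integer points of the triangle, split into vertices and the rest. -/
theorem int_mem_triangle {k m n : ℤ} (hk : 1 ≤ k) (h1 : 0 ≤ 6*k+3 - 2*m - (2*k+1)*n)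
    (h2 : 0 ≤ 2*k*n - m + 1) (h3 : 0 ≤ 3*m + n - 3) :
    (m = 1 ∧ n = 0) ∨ (m = 0 ∧ n = 3) ∨ (m = 2*k+1 ∧ n = 1) ∨
      (1 ≤ m ∧ m ≤ 2*k ∧ n = 1) ∨ (1 ≤ m ∧ m ≤ k ∧ n = 2) := by
  have hn0 : 0 ≤ n := by
    by_contra! h
    nlinarith
  have hn3 : n ≤ 3 := by
    by_contra! h
    nlinarith
  interval_cases n <;> omega

/-- The integer points in the interior of the triangle. -/
theorem int_mem_interior_triangle_iff {k m n : ℤ} (hk : 1 ≤ k) :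
    (0 < 6*k+3 - 2*m - (2*k+1)*n ∧ 0 < 2*k*n - m + 1 ∧ 0 < 3*m + n - 3) ↔
      (1 ≤ m ∧ m ≤ 2*k ∧ n = 1) ∨ (1 ≤ m ∧ m ≤ k ∧ n = 2) := by
  constructor
  · rintro ⟨h1, h2, h3⟩
    rcases int_mem_triangle hk h1.le h2.le h3.le with
      ⟨rfl, rfl⟩ | ⟨rfl, rfl⟩ | ⟨rfl, rfl⟩ | h | h <;> omega
  · rintro (⟨h1, h2, rfl⟩ | ⟨h1, h2, rfl⟩) <;> omega

/-- For every integer `k ≥ 1`, the triangle with vertices `(1,0)`, `(0,3)`, `(2k+1,1)`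
has exactly three boundary lattice points (namely its vertices), exactly `3k` interior
lattice points, and contains `(1,1)`, `(1,2)`, `(2,1)` among its interior lattice points;
in particular its interior lattice points are not all collinear. -/
theorem stmt1 (k : ℤ) (hk : 1 ≤ k)
    (T : Set (ℝ × ℝ))
    (hT : T = convexHull ℝ ({((1:ℝ), (0:ℝ)), ((0:ℝ), (3:ℝ)),
      (((2*k+1 : ℤ) : ℝ), (1:ℝ))} : Set (ℝ × ℝ))) :
    (latticePts (frontier T)).ncard = 3 ∧
    latticePts (frontier T) = ({((1:ℝ), (0:ℝ)), ((0:ℝ), (3:ℝ)),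
      (((2*k+1 : ℤ) : ℝ), (1:ℝ))} : Set (ℝ × ℝ)) ∧
    ((latticePts (interior T)).ncard : ℤ) = 3 * k ∧
    ((1:ℝ), (1:ℝ)) ∈ latticePts (interior T) ∧
    ((1:ℝ), (2:ℝ)) ∈ latticePts (interior T) ∧
    ((2:ℝ), (1:ℝ)) ∈ latticePts (interior T) ∧
    ¬ Collinear ℝ (latticePts (interior T)) := by
  have hk' : (1:ℝ) ≤ k := by exact_mod_cast hk
  have hcast : ((2*k+1 : ℤ) : ℝ) = 2*(k:ℝ)+1 := by push_cast; ring
  have hTeq := hT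
  rw [hcast, convexHull_triangle_eq k hk'] at hTeq
  have hclosed : IsClosed T := hTeq ▸ isClosed_triangle k
  have hint : interior T = _ := hTeq ▸ interior_triangle_s1 k
  have hTmem : ∀ m n : ℤ, ((m:ℝ), (n:ℝ)) ∈ T ↔
      0 ≤ 6*k+3 - 2*m - (2*k+1)*n ∧ 0 ≤ 2*k*n - m + 1 ∧ 0 ≤ 3*m + n - 3 := by
    intro m n
    rw [hTeq, Set.mem_ofPred_eq]
    dsimp only
    norm_cast
  have hintmem : ∀ m n : ℤ, ((m:ℝ), (n:ℝ)) ∈ interior T ↔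
      (1 ≤ m ∧ m ≤ 2*k ∧ n = 1) ∨ (1 ≤ m ∧ m ≤ k ∧ n = 2) := by
    intro m n
    rw [← int_mem_interior_triangle_iff hk, hint, Set.mem_ofPred_eq]
    dsimp only
    norm_cast
  have hfr : latticePts (frontier T) = ({((1:ℝ), (0:ℝ)), ((0:ℝ), (3:ℝ)),
      (((2*k+1 : ℤ) : ℝ), (1:ℝ))} : Set (ℝ × ℝ)) := by
    rw [hclosed.frontier_eq]
    apply Set.Subset.antisymm
    · rintro _ ⟨⟨hp, hp'⟩, m, n, rfl⟩
      obtain ⟨h1, h2, h3⟩ := (hTmem m n).1 hp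
      rw [hintmem] at hp'
      rcases int_mem_triangle hk h1 h2 h3 with ⟨rfl, rfl⟩ | ⟨rfl, rfl⟩ | ⟨rfl, rfl⟩ | h | h
      · simp
      · simp
      · simp
      · exact absurd (Or.inl h) hp'
      · exact absurd (Or.inr h) hp'
    · intro p hp
      have hpT : p ∈ T := hT ▸ subset_convexHull ℝ _ hp
      obtain ⟨m, n, hmn, h⟩ : ∃ m n : ℤ, p = ((m:ℝ), (n:ℝ)) ∧
          ((m = 1 ∧ n = 0) ∨ (m = 0 ∧ n = 3) ∨ (m = 2*k+1 ∧ n = 1)) := by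
        rcases hp with rfl | rfl | rfl
        · exact ⟨1, 0, by simp, by simp⟩
        · exact ⟨0, 3, by simp, by simp⟩
        · exact ⟨2*k+1, 1, by simp, by simp⟩
      refine ⟨⟨hpT, ?_⟩, m, n, hmn⟩
      rw [hmn, hintmem]
      omega
  have hlat : latticePts (interior T) = (fun q : ℤ × ℤ => ((q.1:ℝ), (q.2:ℝ))) ''
      ((Finset.Icc 1 (2*k) ×ˢ {1} ∪ Finset.Icc 1 k ×ˢ {2} : Finset (ℤ × ℤ)) : Set (ℤ × ℤ)) := by
    ext p
    constructor
    · rintro ⟨hp, m, n, rfl⟩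
      refine ⟨(m, n), ?_, rfl⟩
      simpa [and_assoc, eq_comm] using (hintmem m n).1 hp
    · rintro ⟨⟨m, n⟩, hq, rfl⟩
      exact ⟨(hintmem m n).2 (by simpa [and_assoc, eq_comm] using hq), m, n, rfl⟩
  have h11 : ((1:ℝ), (1:ℝ)) ∈ latticePts (interior T) :=
    ⟨by simpa using (hintmem 1 1).2 (by omega), 1, 1, by simp⟩
  have h12 : ((1:ℝ), (2:ℝ)) ∈ latticePts (interior T) :=
    ⟨by simpa using (hintmem 1 2).2 (by omega), 1, 2, by simp⟩
  have h21 : ((2:ℝ), (1:ℝ)) ∈ latticePts (interior T) :=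
    ⟨by simpa using (hintmem 2 1).2 (by omega), 2, 1, by simp⟩
  refine ⟨?_, hfr, ?_, h11, h12, h21, ?_⟩
  · rw [hfr, Set.ncard_eq_three]
    exact ⟨_, _, _, by simp, by simp, by simp, rfl⟩
  · have hinj : Function.Injective (fun q : ℤ × ℤ => ((q.1:ℝ), (q.2:ℝ))) := by
      rintro ⟨a, b⟩ ⟨c, d⟩ h
      simpa using h
    rw [hlat, Set.ncard_image_of_injective _ hinj, Set.ncard_coe_finset,
      Finset.card_union_of_disjoint]
    · simp only [Finset.card_product, Int.card_Icc, Finset.card_singleton]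
      omega
    · rw [Finset.disjoint_left]
      rintro ⟨a, b⟩ h h'
      simp only [Finset.mem_product, Finset.mem_singleton] at h h'
      omega
  · intro hcol
    obtain ⟨⟨a, b⟩, hv⟩ := (collinear_iff_of_mem h11).1 hcol
    obtain ⟨r, hr⟩ := hv _ h12
    obtain ⟨s, hs⟩ := hv _ h21
    simp only [vadd_eq_add, Prod.smul_mk, smul_eq_mul, Prod.mk_add_mk, Prod.mk.injEq] at hr hs
    obtain ⟨hr1, hr2⟩ := hr
    obtain ⟨hs1, hs2⟩ := hs
    have e1 : r * a = 0 := by linarith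
    have e2 : r * b = 1 := by linarith
    have e3 : s * a = 1 := by linarith
    rcases mul_eq_zero.1 e1 with h | h <;> simp [h] at e2 e3
end

section
/- Every lattice triangle with exactly three boundary lattice points and exactly g interior lattice points is unimodularly equivalent to the triangle with vertices (0,0), (0,1), and (2g+1, b) for some integer b with 0 ≤ b ≤ 2g+1, gcd(2g+1, b) = 1, and gcd(2g+1, b−1) = 1. -/
/-- A map `ℝ² → ℝ²` is unimodular affine if it is given by `x ↦ Ax + v` for a
`2 × 2` integer matrix `A` of determinant `±1` and an integer vector `v`. -/
def UnimodularMap (f : ℝ × ℝ → ℝ × ℝ) : Prop :=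
  ∃ (a b c d e₁ e₂ : ℤ), (a * d - b * c = 1 ∨ a * d - b * c = -1) ∧
    ∀ p : ℝ × ℝ, f p = ((a : ℝ) * p.1 + (b : ℝ) * p.2 + (e₁ : ℝ),
                        (c : ℝ) * p.1 + (d : ℝ) * p.2 + (e₂ : ℝ))

/-- A point at which an affine function bounded below on `S` attains its bound is not interior. -/
theorem lt_of_mem_interior_of_forall_le {S : Set (ℝ × ℝ)} {α β c : ℝ} (hαβ : α ≠ 0 ∨ β ≠ 0)
    (hS : ∀ x ∈ S, c ≤ α * x.1 + β * x.2) {x : ℝ × ℝ} (hx : x ∈ interior S) :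
    c < α * x.1 + β * x.2 := by
  have hcont : Filter.Tendsto (fun t : ℝ => (x.1 - t * α, x.2 - t * β)) (nhds 0) (nhds x) := by
    have h : Continuous fun t : ℝ => (x.1 - t * α, x.2 - t * β) := by fun_prop
    simpa using h.tendsto 0
  have hev := hcont.eventually (mem_interior_iff_mem_nhds.mp hx)
  obtain ⟨ε, hε, hball⟩ := Metric.eventually_nhds_iff.mp hev
  have hmem := hS _ (hball (y := ε / 2) (by
    rw [Real.dist_eq, sub_zero, abs_of_pos (by positivity)]; linarith))
  have hpos : 0 < α ^ 2 + β ^ 2 := by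
    rcases hαβ with h | h <;> positivity
  simp only at hmem
  nlinarith [mul_pos hε hpos]

/-- The triangle with vertices `(0,0)`, `(0,d)`, `(h,b)`. -/
def standardTriangle (d h b : ℝ) : Set (ℝ × ℝ) :=
  convexHull ℝ {((0 : ℝ), (0 : ℝ)), ((0 : ℝ), d), (h, b)}

theorem mem_standardTriangle_iff {d h b : ℝ} (hd : 0 < d) (hh : 0 < h) (x : ℝ × ℝ) :
    x ∈ standardTriangle d h b ↔
      0 ≤ x.1 ∧ b * x.1 ≤ h * x.2 ∧ h * x.2 ≤ h * d + (b - d) * x.1 := by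
  constructor
  · intro hx
    have hconv : Convex ℝ {x : ℝ × ℝ |
        0 ≤ x.1 ∧ b * x.1 ≤ h * x.2 ∧ h * x.2 ≤ h * d + (b - d) * x.1} := by
      rintro ⟨x₁, x₂⟩ ⟨h1, h2, h3⟩ ⟨y₁, y₂⟩ ⟨k1, k2, k3⟩ s t hs ht hst
      obtain rfl : t = 1 - s := by linarith
      simp only [Prod.smul_mk, Prod.mk_add_mk, smul_eq_mul, Set.mem_ofPred_eq] at *
      refine ⟨by positivity, ?_, ?_⟩ <;>
        nlinarith [mul_le_mul_of_nonneg_left h2 hs, mul_le_mul_of_nonneg_left k2 ht,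
          mul_le_mul_of_nonneg_left h3 hs, mul_le_mul_of_nonneg_left k3 ht]
    refine convexHull_min ?_ hconv hx
    rintro y (rfl | rfl | rfl)
    · simp only [Set.mem_ofPred_eq]
      refine ⟨le_rfl, by simp, by simp; positivity⟩
    · simp only [Set.mem_ofPred_eq]
      refine ⟨le_rfl, by simp; positivity, by simp⟩
    · simp only [Set.mem_ofPred_eq]
      exact ⟨hh.le, by linarith, by linarith⟩
  · rintro ⟨h1, h2, h3⟩
    have hsum := (convex_convexHull ℝ ({((0 : ℝ), (0 : ℝ)), ((0 : ℝ), d), (h, b)} :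
        Set (ℝ × ℝ))).sum_mem (t := Finset.univ)
      (w := ![(h * d + (b - d) * x.1 - h * x.2) / (h * d), (h * x.2 - b * x.1) / (h * d),
        x.1 / h])
      (z := ![((0 : ℝ), (0 : ℝ)), ((0 : ℝ), d), (h, b)])
      (by
        intro i _
        fin_cases i
        · exact div_nonneg (by linarith) (by positivity)
        · exact div_nonneg (by linarith) (by positivity)
        · exact div_nonneg h1 hh.le)
      (by
        simp [Fin.sum_univ_three]
        field_simp
        ring)
      (by
        intro i _
        apply subset_convexHull
        fin_cases i <;> simp)
    unfold standardTriangle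
    convert hsum using 1
    ext
    · simp [Fin.sum_univ_three]
      field_simp
    · simp [Fin.sum_univ_three]
      field_simp
      ring

theorem mem_interior_standardTriangle_iff {d h b : ℝ} (hd : 0 < d) (hh : 0 < h) (x : ℝ × ℝ) :
    x ∈ interior (standardTriangle d h b) ↔
      0 < x.1 ∧ b * x.1 < h * x.2 ∧ h * x.2 < h * d + (b - d) * x.1 := by
  have hmem := fun y => mem_standardTriangle_iff (b := b) hd hh y
  constructor
  · intro hx
    refine ⟨?_, ?_, ?_⟩
    · have := lt_of_mem_interior_of_forall_le (α := 1) (β := 0) (c := 0) (by simp)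
        (fun y hy => by linarith [((hmem y).1 hy).1]) hx
      linarith
    · have := lt_of_mem_interior_of_forall_le (α := -b) (β := h) (c := 0) (Or.inr hh.ne')
        (fun y hy => by linarith [((hmem y).1 hy).2.1]) hx
      linarith
    · have := lt_of_mem_interior_of_forall_le (α := b - d) (β := -h) (c := -(h * d))
        (Or.inr (neg_ne_zero.2 hh.ne')) (fun y hy => by linarith [((hmem y).1 hy).2.2]) hx
      linarith
  · intro hx
    refine interior_maximal
      (t := {y : ℝ × ℝ | 0 < y.1 ∧ b * y.1 < h * y.2 ∧ h * y.2 < h * d + (b - d) * y.1})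
      ?_ ?_ hx
    · rintro y ⟨h1, h2, h3⟩
      exact (hmem y).2 ⟨h1.le, h2.le, h3.le⟩
    · simp only [Set.ofPred_and]
      exact (isOpen_lt (by fun_prop) (by fun_prop)).inter
        ((isOpen_lt (by fun_prop) (by fun_prop)).inter (isOpen_lt (by fun_prop) (by fun_prop)))

/-- A lattice point of the triangle satisfying one of its edge equations is a boundary lattice
point. -/
theorem mem_latticePts_frontier_standardTriangle {d h b m n : ℤ} (hd : 0 < d) (hh : 0 < h)
    (h1 : 0 ≤ m) (h2 : b * m ≤ h * n) (h3 : h * n ≤ h * d + (b - d) * m)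
    (hedge : m = 0 ∨ b * m = h * n ∨ h * n = h * d + (b - d) * m) :
    ((m : ℝ), (n : ℝ)) ∈ latticePts (frontier (standardTriangle d h b)) := by
  have hd' : (0 : ℝ) < d := by exact_mod_cast hd
  have hh' : (0 : ℝ) < h := by exact_mod_cast hh
  have hmem : ((m : ℝ), (n : ℝ)) ∈ standardTriangle d h b := by
    rw [mem_standardTriangle_iff hd' hh']
    simp only
    exact ⟨by exact_mod_cast h1, by exact_mod_cast h2, by exact_mod_cast h3⟩
  have hint : ((m : ℝ), (n : ℝ)) ∉ interior (standardTriangle d h b) := by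
    rw [mem_interior_standardTriangle_iff hd' hh']
    simp only
    norm_cast
    omega
  exact ⟨Set.mem_sdiff_of_mem (subset_closure hmem) hint, m, n, rfl⟩

/-- If the triangle has only three boundary lattice points, these are its vertices. -/
theorem eq_vertex_of_ncard_eq_three {d h b m n : ℤ} (hd : 0 < d) (hh : 0 < h)
    (hcard : (latticePts (frontier (standardTriangle d h b))).ncard = 3)
    (h1 : 0 ≤ m) (h2 : b * m ≤ h * n) (h3 : h * n ≤ h * d + (b - d) * m)
    (hedge : m = 0 ∨ b * m = h * n ∨ h * n = h * d + (b - d) * m) :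
    m = 0 ∧ n = 0 ∨ m = 0 ∧ n = d ∨ m = h ∧ n = b := by
  have hfin := Set.finite_of_ncard_ne_zero (by omega :
    (latticePts (frontier (standardTriangle d h b))).ncard ≠ 0)
  have hhd : 0 < h * d := mul_pos hh hd
  have hsub : ({((0 : ℤ), (0 : ℤ)), (0, d), (h, b)} : Finset (ℤ × ℤ)).card = 3 := by
    rw [Finset.card_eq_three]
    refine ⟨_, _, _, ?_, ?_, ?_, rfl⟩ <;> simp <;> omega
  let e : ℤ × ℤ → ℝ × ℝ := fun z => ((z.1 : ℝ), (z.2 : ℝ))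
  have he : Function.Injective e := by
    rintro ⟨a, b⟩ ⟨a', b'⟩ h
    simpa [e] using h
  have heq : e '' (({((0 : ℤ), (0 : ℤ)), (0, d), (h, b)} : Finset (ℤ × ℤ)) : Set (ℤ × ℤ)) =
      latticePts (frontier (standardTriangle d h b)) := by
    refine Set.eq_of_subset_of_ncard_le ?_ ?_ hfin
    · rintro _ ⟨z, hz, rfl⟩
      simp only [Finset.coe_insert, Finset.coe_singleton, Set.mem_insert_iff,
        Set.mem_singleton_iff] at hz
      rcases hz with rfl | rfl | rfl
      · exact mem_latticePts_frontier_standardTriangle hd hh le_rfl (by simp)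
          (by simp; exact hhd.le) (by simp)
      · exact mem_latticePts_frontier_standardTriangle hd hh le_rfl (by simp; exact hhd.le)
          (by simp) (by simp)
      · exact mem_latticePts_frontier_standardTriangle hd hh hh.le (by simp [mul_comm])
          (by simp only; linarith) (Or.inr (Or.inl (mul_comm _ _)))
    · rw [Set.ncard_image_of_injective _ he, Set.ncard_coe_finset, hsub, hcard]
  have hmem := mem_latticePts_frontier_standardTriangle hd hh h1 h2 h3 hedge
  rw [← heq] at hmem
  obtain ⟨z, hz, hze⟩ := hmem
  obtain rfl : z = (m, n) := he hze
  simpa using hz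

/-- Exactly half of the residues `0 < x < h` satisfy `x < b x mod h` when `b` and `b - 1` are
units modulo `h`. -/
theorem two_mul_card_lt_mul_emod {h b : ℤ} (hh : 0 < h) (hb : Int.gcd h b = 1)
    (hb' : Int.gcd h (b - 1) = 1) :
    2 * (((Finset.Ioo 0 h).filter fun x => x < b * x % h).card : ℤ) + 1 = h := by
  have hcard : ((Finset.Ioo 0 h).filter fun x => x < b * x % h).card =
      ((Finset.Ioo 0 h).filter fun x => ¬ x < b * x % h).card := by
    have hrefl : ∀ x, 0 < x → x < h → b * (h - x) % h = h - b * x % h := by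
      intro x h0 h1
      have hne : b * x % h ≠ 0 := fun h0' => by
        have := Int.le_of_dvd h0
          (IsCoprime.dvd_of_dvd_mul_left (Int.isCoprime_iff_gcd_eq_one.2 hb)
            (Int.dvd_of_emod_eq_zero h0'))
        omega
      have hlo := Int.emod_nonneg (b * x) hh.ne'
      have hhi := Int.emod_lt_of_pos (b * x) hh
      have hrw : b * (h - x) = (h - b * x % h) + h * (b - b * x / h - 1) := by
        linear_combination Int.mul_ediv_add_emod (b * x) h
      rw [hrw, Int.add_mul_emod_self_left, Int.emod_eq_of_lt (by omega) (by omega)]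
    have hne : ∀ x, 0 < x → x < h → b * x % h ≠ x := by
      intro x h0 h1 heq
      have hdvd : h ∣ (b - 1) * x :=
        ⟨b * x / h, by linear_combination heq - Int.mul_ediv_add_emod (b * x) h⟩
      have := Int.le_of_dvd h0
        (IsCoprime.dvd_of_dvd_mul_left (Int.isCoprime_iff_gcd_eq_one.2 hb') hdvd)
      omega
    refine Finset.card_bij' (fun x _ => h - x) (fun x _ => h - x) ?_ ?_ ?_ ?_
    · intro x hx
      simp only [Finset.mem_filter, Finset.mem_Ioo] at hx ⊢
      rw [hrefl x hx.1.1 hx.1.2]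
      omega
    · intro x hx
      simp only [Finset.mem_filter, Finset.mem_Ioo] at hx ⊢
      have := hne x hx.1.1 hx.1.2
      rw [hrefl x hx.1.1 hx.1.2]
      omega
    · intros; ring
    · intros; ring
  have htot := Finset.card_filter_add_card_filter_not (s := Finset.Ioo 0 h)
    (fun x => x < b * x % h)
  rw [Int.card_Ioo] at htot
  omega

theorem two_mul_ncard_interior_standardTriangle {h b : ℤ} (hh : 0 < h) (hb : Int.gcd h b = 1)
    (hb' : Int.gcd h (b - 1) = 1) :
    2 * ((latticePts (interior (standardTriangle 1 h b))).ncard : ℤ) + 1 = h := by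
  have hh' : (0 : ℝ) < h := by exact_mod_cast hh
  have heq : latticePts (interior (standardTriangle 1 h b)) =
      (fun x : ℤ => ((x : ℝ), ((b * x / h + 1 : ℤ) : ℝ))) ''
        ((Finset.Ioo 0 h).filter fun x => x < b * x % h) := by
    ext z
    constructor
    · rintro ⟨hz, m, n, rfl⟩
      have := (mem_interior_standardTriangle_iff one_pos hh' _).1 hz
      simp only at this
      norm_cast at this
      obtain ⟨h1, h2, h3⟩ := this
      have hdiv : b * m / h = n - 1 := by
        rw [Int.ediv_eq_iff_of_pos hh]
        constructor <;> nlinarith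
      refine ⟨m, ?_, by simp [hdiv]⟩
      have := Int.mul_ediv_add_emod (b * m) h
      rw [hdiv] at this
      simp only [Finset.coe_filter, Finset.mem_Ioo, Set.mem_ofPred_eq]
      refine ⟨⟨h1, ?_⟩, ?_⟩ <;> nlinarith
    · rintro ⟨m, hm, rfl⟩
      simp only [Finset.coe_filter, Finset.mem_Ioo, Set.mem_ofPred_eq] at hm
      refine ⟨(mem_interior_standardTriangle_iff one_pos hh' _).2 ?_, _, _, rfl⟩
      have h1 := Int.mul_ediv_add_emod (b * m) h
      have h2 := Int.emod_lt_of_pos (b * m) hh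
      simp only
      norm_cast
      refine ⟨hm.1.1, ?_, ?_⟩ <;> nlinarith [hm.2]
  rw [heq, Set.ncard_image_of_injective, Set.ncard_coe_finset]
  · exact two_mul_card_lt_mul_emod hh hb hb'
  · intro x y hxy
    simpa using congrArg Prod.fst hxy

/-- Two linearly independent integer vectors can be brought to the form `(0, k)`, `(h, e)` with
`0 < k` and `0 ≤ e < h` by a unimodular matrix. -/
theorem exists_unimodular_normal_form {u v w z : ℤ} (hne : u * z - v * w ≠ 0) :
    ∃ a b c d : ℤ, (a * d - b * c = 1 ∨ a * d - b * c = -1) ∧ a * u + b * v = 0 ∧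
      0 < c * u + d * v ∧ 0 < a * w + b * z ∧ 0 ≤ c * w + d * z ∧
      c * w + d * z < a * w + b * z := by
  have hg : 0 < Int.gcd u v := Int.gcd_pos_iff.2 (by
    by_contra! h
    simp [h.1, h.2] at hne)
  obtain ⟨k, u', v', hk, hcop, hu, hv⟩ : ∃ (k : ℤ) (u' v' : ℤ), 0 < k ∧ IsCoprime u' v' ∧
      u = k * u' ∧ v = k * v' := by
    obtain ⟨u', hu⟩ := Int.gcd_dvd_left u v
    obtain ⟨v', hv⟩ := Int.gcd_dvd_right u v
    refine ⟨Int.gcd u v, u', v', by exact_mod_cast hg, ?_, hu, hv⟩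
    refine ⟨Int.gcdA u v, Int.gcdB u v, ?_⟩
    have := Int.gcd_eq_gcd_ab u v
    apply mul_left_cancel₀ (a := (Int.gcd u v : ℤ)) (by exact_mod_cast hg.ne')
    linear_combination -this - Int.gcdA u v * hu - Int.gcdB u v * hv
  obtain ⟨s, t, hst⟩ := hcop
  subst hu hv
  obtain ⟨σ, hσ, hpos⟩ : ∃ σ : ℤ, (σ = 1 ∨ σ = -1) ∧ 0 < σ * (v' * w - u' * z) := by
    have : v' * w - u' * z ≠ 0 := fun h => hne (by linear_combination -k * h)
    rcases lt_or_gt_of_ne this with h | h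
    · exact ⟨-1, by simp, by linarith⟩
    · exact ⟨1, by simp, by linarith⟩
  set h := σ * (v' * w - u' * z) with hh
  set l := (s * w + t * z) / h with hl
  have hdiv := Int.mul_ediv_add_emod (s * w + t * z) h
  have hrw : (s - l * (σ * v')) * w + (t + l * (σ * u')) * z = (s * w + t * z) % h := by
    rw [← hl] at hdiv
    linear_combination -hdiv + l * hh
  have hrw' : σ * v' * w + -(σ * u') * z = h := by rw [hh]; ring
  refine ⟨σ * v', -(σ * u'), s - l * (σ * v'), t + l * (σ * u'), ?_, by ring, ?_, ?_, ?_, ?_⟩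
  · have : σ * v' * (t + l * (σ * u')) - -(σ * u') * (s - l * (σ * v')) = σ := by
      linear_combination σ * hst
    rwa [this]
  · have : (s - l * (σ * v')) * (k * u') + (t + l * (σ * u')) * (k * v') = k := by
      linear_combination k * hst
    rwa [this]
  · rwa [hrw']
  · rw [hrw]; exact Int.emod_nonneg _ hpos.ne'
  · rw [hrw, hrw']; exact Int.emod_lt_of_pos _ hpos

/-- Three points with vanishing determinant are collinear. -/
theorem collinear_of_det_eq_zero {p q r : ℝ × ℝ}
    (h : (q.1 - p.1) * (r.2 - p.2) - (q.2 - p.2) * (r.1 - p.1) = 0) :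
    Collinear ℝ ({p, q, r} : Set (ℝ × ℝ)) := by
  by_cases hpq : q = p
  · subst hpq
    simpa using collinear_pair ℝ q r
  rw [collinear_iff_of_mem (p₀ := p) (by simp)]
  refine ⟨q - p, ?_⟩
  rintro x (rfl | rfl | rfl)
  · exact ⟨0, by simp⟩
  · exact ⟨1, by simp⟩
  · by_cases h1 : q.1 - p.1 = 0
    · have h2 : q.2 - p.2 ≠ 0 := fun h2 =>
        hpq (Prod.ext (sub_eq_zero.1 h1) (sub_eq_zero.1 h2))
      refine ⟨(x.2 - p.2) / (q.2 - p.2), ?_⟩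
      ext <;> simp <;> field_simp <;> linarith
    · refine ⟨(x.1 - p.1) / (q.1 - p.1), ?_⟩
      ext <;> simp <;> field_simp <;> linarith

namespace UnimodularMap

theorem latticePt {f : ℝ × ℝ → ℝ × ℝ} (hf : UnimodularMap f) {x : ℝ × ℝ} (hx : LatticePt x) :
    LatticePt (f x) := by
  obtain ⟨a, b, c, d, e₁, e₂, -, h⟩ := hf
  obtain ⟨m, n, rfl⟩ := hx
  exact ⟨a * m + b * n + e₁, c * m + d * n + e₂, by rw [h]; push_cast; rfl⟩

theorem continuous {f : ℝ × ℝ → ℝ × ℝ} (hf : UnimodularMap f) : Continuous f := by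
  obtain ⟨a, b, c, d, e₁, e₂, -, h⟩ := hf
  rw [funext h]
  fun_prop

theorem exists_inverse {f : ℝ × ℝ → ℝ × ℝ} (hf : UnimodularMap f) :
    ∃ f' : ℝ × ℝ → ℝ × ℝ, UnimodularMap f' ∧ Function.LeftInverse f' f ∧
      Function.RightInverse f' f := by
  obtain ⟨a, b, c, d, e₁, e₂, hdet, h⟩ := hf
  obtain ⟨σ, hσ, hσ1⟩ : ∃ σ : ℤ, (a * d - b * c) * σ = 1 ∧ (σ = 1 ∨ σ = -1) := by
    rcases hdet with h | h <;> [exact ⟨1, by simp [h]⟩; exact ⟨-1, by simp [h]⟩]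
  have hσ' : ((a : ℝ) * d - b * c) * σ = 1 := by exact_mod_cast hσ
  refine ⟨fun x => (((σ * d : ℤ) : ℝ) * x.1 + ((-σ * b : ℤ) : ℝ) * x.2 +
      ((σ * (b * e₂ - d * e₁) : ℤ) : ℝ), ((-σ * c : ℤ) : ℝ) * x.1 + ((σ * a : ℤ) : ℝ) * x.2 +
      ((σ * (c * e₁ - a * e₂) : ℤ) : ℝ)),
    ⟨_, _, _, _, _, _, ?_, fun _ => rfl⟩, fun x => ?_, fun x => ?_⟩
  · have : σ * d * (σ * a) - -σ * b * (-σ * c) = σ := by linear_combination σ * hσ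
    rwa [this]
  · rw [h]
    ext <;> push_cast
    · linear_combination x.1 * hσ'
    · linear_combination x.2 * hσ'
  · rw [h]
    ext <;> push_cast
    · linear_combination (x.1 - e₁) * hσ'
    · linear_combination (x.2 - e₂) * hσ'

theorem exists_homeomorph {f : ℝ × ℝ → ℝ × ℝ} (hf : UnimodularMap f) :
    ∃ F : (ℝ × ℝ) ≃ₜ (ℝ × ℝ), ⇑F = f ∧ ∀ x, LatticePt (F x) ↔ LatticePt x := by
  obtain ⟨f', hf', hl, hr⟩ := hf.exists_inverse
  refine ⟨⟨⟨f, f', hl, hr⟩, hf.continuous, hf'.continuous⟩, rfl,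
    fun x => ⟨fun hx => ?_, fun hx => hf.latticePt hx⟩⟩
  have := hf'.latticePt hx
  exact (hl x) ▸ this

theorem image_convexHull {f : ℝ × ℝ → ℝ × ℝ} (hf : UnimodularMap f) (S : Set (ℝ × ℝ)) :
    f '' convexHull ℝ S = convexHull ℝ (f '' S) := by
  obtain ⟨a, b, c, d, e₁, e₂, -, h⟩ := hf
  let L : (ℝ × ℝ) →ₗ[ℝ] (ℝ × ℝ) :=
    { toFun := fun x => ((a : ℝ) * x.1 + b * x.2, (c : ℝ) * x.1 + d * x.2)
      map_add' := fun x y => by ext <;> simp <;> ring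
      map_smul' := fun t x => by ext <;> simp <;> ring }
  let A : (ℝ × ℝ) →ᵃ[ℝ] (ℝ × ℝ) := L.toAffineMap + AffineMap.const ℝ _ ((e₁ : ℝ), (e₂ : ℝ))
  obtain rfl : f = A := funext fun x => by rw [h]; simp [A, L]
  exact A.image_convexHull S

end UnimodularMap

/-- A homeomorphism preserving lattice points preserves their number in corresponding sets. -/
theorem ncard_latticePts_image (F : (ℝ × ℝ) ≃ₜ (ℝ × ℝ)) (hF : ∀ x, LatticePt (F x) ↔ LatticePt x)
    (S : Set (ℝ × ℝ)) : (latticePts (F '' S)).ncard = (latticePts S).ncard := by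
  have : latticePts (F '' S) = F '' latticePts S := by
    ext y
    constructor
    · rintro ⟨⟨x, hx, rfl⟩, hy⟩
      exact ⟨x, ⟨hx, (hF x).1 hy⟩, rfl⟩
    · rintro ⟨x, ⟨hx, hl⟩, rfl⟩
      exact ⟨⟨x, hx, rfl⟩, (hF x).2 hl⟩
  rw [this, Set.ncard_image_of_injective _ F.injective]

/-- A lattice triangle in normal form with three boundary lattice points has primitive edges. -/
theorem primitive_of_ncard_frontier_eq_three {d h b : ℤ} (hd : 0 < d) (hh : 0 < h)
    (hcard : (latticePts (frontier (standardTriangle d h b))).ncard = 3) :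
    d = 1 ∧ Int.gcd h b = 1 ∧ Int.gcd h (b - 1) = 1 := by
  have hd1 : d = 1 := by
    have := eq_vertex_of_ncard_eq_three (m := 0) (n := 1) hd hh hcard le_rfl (by linarith)
      (by nlinarith) (by simp)
    omega
  subst hd1
  have key : ∀ c : ℤ, (∀ k m n : ℤ, 0 < k → h = k * m → c = k * n → 0 < m → m = h) →
      Int.gcd h c = 1 := by
    intro c hc
    obtain ⟨m, hm⟩ := Int.gcd_dvd_left h c
    obtain ⟨n, hn⟩ := Int.gcd_dvd_right h c
    have hk : (0 : ℤ) < Int.gcd h c := by exact_mod_cast Int.gcd_pos_of_ne_zero_left c hh.ne'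
    have hm0 : 0 < m := pos_of_mul_pos_right (hm ▸ hh) hk.le
    have hmh := hc _ m n hk hm hn hm0
    rw [hmh] at hm
    have : (Int.gcd h c : ℤ) = 1 := mul_right_cancel₀ hh.ne' (by linarith)
    exact_mod_cast this
  refine ⟨rfl, key b fun k m n hk hm hn hm0 => ?_, key (b - 1) fun k m n hk hm hn hm0 => ?_⟩
  · have hedge : b * m = h * n := by rw [hm, hn]; ring
    have hmh : m ≤ h := by nlinarith
    have := eq_vertex_of_ncard_eq_three (m := m) (n := n) hd hh hcard hm0.le hedge.le
      (by linarith) (by simp [hedge])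
    omega
  · have hedge : (b - 1) * m = h * n := by rw [hm, hn]; ring
    have hmh : m ≤ h := by nlinarith
    have := eq_vertex_of_ncard_eq_three (b := b) (m := m) (n := 1 + n) hd hh hcard hm0.le
      (by linarith) (by linarith) (by right; right; linarith)
    omega

/-- Every lattice triangle with exactly three boundary lattice points and exactly `g`
interior lattice points is unimodularly equivalent to the triangle with vertices
`(0,0)`, `(0,1)`, `(2g+1, b)` for some `0 ≤ b ≤ 2g+1` with
`gcd(2g+1, b) = gcd(2g+1, b-1) = 1`. -/
theorem stmt4 (p q r : ℝ × ℝ) (hp : LatticePt p) (hq : LatticePt q) (hr : LatticePt r)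
    (hdim : ¬ Collinear ℝ ({p, q, r} : Set (ℝ × ℝ)))
    (T : Set (ℝ × ℝ)) (hT : T = convexHull ℝ ({p, q, r} : Set (ℝ × ℝ)))
    (g : ℕ)
    (hbd : (latticePts (frontier T)).ncard = 3)
    (hint : (latticePts (interior T)).ncard = g) :
    ∃ b : ℤ, 0 ≤ b ∧ b ≤ 2 * (g : ℤ) + 1 ∧
      Int.gcd (2 * (g : ℤ) + 1) b = 1 ∧ Int.gcd (2 * (g : ℤ) + 1) (b - 1) = 1 ∧
      ∃ f : ℝ × ℝ → ℝ × ℝ, UnimodularMap f ∧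
        f '' T = convexHull ℝ ({((0:ℝ), (0:ℝ)), ((0:ℝ), (1:ℝ)),
          (((2 * (g : ℤ) + 1 : ℤ) : ℝ), ((b : ℤ) : ℝ))} : Set (ℝ × ℝ)) := by
  obtain ⟨p₁, p₂, rfl⟩ := hp
  obtain ⟨q₁, q₂, rfl⟩ := hq
  obtain ⟨r₁, r₂, rfl⟩ := hr
  have hne : (q₁ - p₁) * (r₂ - p₂) - (q₂ - p₂) * (r₁ - p₁) ≠ 0 := fun h =>
    hdim (collinear_of_det_eq_zero (by simp only; exact_mod_cast h))
  obtain ⟨a, b, c, d, hdet, hzero, hk, hh, he, heh⟩ := exists_unimodular_normal_form hne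
  set k := c * (q₁ - p₁) + d * (q₂ - p₂) with hk_def
  set h := a * (r₁ - p₁) + b * (r₂ - p₂) with hh_def
  set e := c * (r₁ - p₁) + d * (r₂ - p₂) with he_def
  let f : ℝ × ℝ → ℝ × ℝ := fun x =>
    ((a : ℝ) * x.1 + (b : ℝ) * x.2 + ((-(a * p₁ + b * p₂) : ℤ) : ℝ),
      (c : ℝ) * x.1 + (d : ℝ) * x.2 + ((-(c * p₁ + d * p₂) : ℤ) : ℝ))
  have hf : UnimodularMap f := ⟨a, b, c, d, _, _, hdet, fun _ => rfl⟩
  have himage : f '' T = standardTriangle k h e := by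
    rw [hT, hf.image_convexHull, Set.image_insert_eq, Set.image_insert_eq, Set.image_singleton,
      standardTriangle]
    have hzero' : (a : ℝ) * (q₁ - p₁) + b * (q₂ - p₂) = 0 := by exact_mod_cast hzero
    congr! 2
    · ext <;> simp [f]
    · congr! 1
      · ext <;> simp [f, hk_def] <;> linarith
      · congr 1
        ext <;> simp [f, hh_def, he_def] <;> ring
  obtain ⟨F, hF, hlat⟩ := hf.exists_homeomorph
  rw [← ncard_latticePts_image F hlat, F.image_frontier, hF, himage] at hbd
  rw [← ncard_latticePts_image F hlat, F.image_interior, hF, himage] at hint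
  obtain ⟨hk1, hg, hg'⟩ := primitive_of_ncard_frontier_eq_three hk hh hbd
  rw [hk1, Int.cast_one] at himage hint
  have hcount := two_mul_ncard_interior_standardTriangle hh hg hg'
  rw [hint] at hcount
  rw [hcount]
  exact ⟨e, he, heh.le, hg, hg', f, hf, himage⟩
end

section
/- Let g and b be integers with 4 ≤ b, 2b ≤ 2g+1, gcd(2g+1, b) = 1, and gcd(2g+1, b−1) = 1. Then the triangle with vertices (0,0), (0,1), and (2g+1, b) has at least two interior lattice points with second coordinate equal to 1 and at least one interior lattice point with second coordinate equal to 2; in particular, its interior lattice points are not all collinear. -/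
/-- A point satisfying the three strict edge inequalities of the triangle with vertices `(0, 0)`,
`(0, 1)`, `(N, b)` lies in its interior. -/
theorem mem_interior_triangle {N b x y : ℝ} (hN : 0 < N) (hx : 0 < x) (h₁ : b * x < N * y)
    (h₂ : N * y < N + (b - 1) * x) :
    (x, y) ∈ interior (convexHull ℝ ({((0:ℝ), (0:ℝ)), ((0:ℝ), (1:ℝ)), (N, b)} : Set (ℝ × ℝ))) := by
  let U : Set (ℝ × ℝ) := {p | 0 < p.1 ∧ b * p.1 < N * p.2 ∧ N * p.2 < N + (b - 1) * p.1}
  have hU : IsOpen U := by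
    refine IsOpen.and ?_ (IsOpen.and ?_ ?_) <;> exact isOpen_lt (by fun_prop) (by fun_prop)
  have hxy : (x, y) ∈ U := ⟨hx, h₁, h₂⟩
  refine interior_maximal ?_ hU hxy
  rintro ⟨u, v⟩ ⟨hu, hl, hr⟩
  simp only at hu hl hr
  have hmem := (convex_convexHull ℝ
    ({((0:ℝ), (0:ℝ)), ((0:ℝ), (1:ℝ)), (N, b)} : Set (ℝ × ℝ))).sum_mem
    (t := Finset.univ) (w := ![(N + (b - 1) * u - N * v) / N, (N * v - b * u) / N, u / N])
    (z := ![((0:ℝ), (0:ℝ)), ((0:ℝ), (1:ℝ)), (N, b)]) ?_ ?_ ?_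
  · convert hmem using 1
    simp only [Fin.sum_univ_three, Matrix.cons_val]
    ext
    · simp [hN.ne']
    · simp
      field_simp
      ring
  · intro i _
    fin_cases i
    · exact div_nonneg (by linarith) hN.le
    · exact div_nonneg (by linarith) hN.le
    · exact div_nonneg hu.le hN.le
  · simp only [Fin.sum_univ_three, Matrix.cons_val]
    field_simp
    ring
  · intro i _
    apply subset_convexHull
    fin_cases i <;> simp

/-- If `4 ≤ b`, `2b ≤ 2g+1`, `gcd(2g+1, b) = 1`, and `gcd(2g+1, b-1) = 1`, then the
triangle with vertices `(0,0)`, `(0,1)`, `(2g+1, b)` has at least two interior lattice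
points at height `1` and at least one at height `2`; in particular its interior lattice
points are not all collinear. -/
theorem stmt6 (g b : ℤ) (hb4 : 4 ≤ b) (hb : 2 * b ≤ 2 * g + 1)
    (hgcd1 : Int.gcd (2 * g + 1) b = 1) (hgcd2 : Int.gcd (2 * g + 1) (b - 1) = 1)
    (T : Set (ℝ × ℝ))
    (hT : T = convexHull ℝ ({((0:ℝ), (0:ℝ)), ((0:ℝ), (1:ℝ)),
      (((2 * g + 1 : ℤ) : ℝ), ((b : ℤ) : ℝ))} : Set (ℝ × ℝ))) :
    (∃ p₁ p₂ : ℝ × ℝ, p₁ ≠ p₂ ∧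
      p₁ ∈ latticePts (interior T) ∧ p₂ ∈ latticePts (interior T) ∧
      p₁.2 = 1 ∧ p₂.2 = 1) ∧
    (∃ p₃ : ℝ × ℝ, p₃ ∈ latticePts (interior T) ∧ p₃.2 = 2) ∧
    ¬ Collinear ℝ (latticePts (interior T)) := by
  subst hT
  have key : ∀ x y : ℤ, 0 < x → b * x < (2 * g + 1) * y →
      (2 * g + 1) * y < (2 * g + 1) + (b - 1) * x →
      ((x : ℝ), (y : ℝ)) ∈ latticePts (interior (convexHull ℝ ({((0:ℝ), (0:ℝ)), ((0:ℝ), (1:ℝ)),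
        (((2 * g + 1 : ℤ) : ℝ), ((b : ℤ) : ℝ))} : Set (ℝ × ℝ)))) := by
    intro x y hx h₁ h₂
    refine ⟨mem_interior_triangle ?_ ?_ ?_ ?_, x, y, rfl⟩
    · exact_mod_cast (by linarith : 0 < 2 * g + 1)
    · exact_mod_cast hx
    · exact_mod_cast h₁
    · exact_mod_cast h₂
  have h11 := key 1 1 (by norm_num) (by linarith) (by linarith)
  have h21 := key 2 1 (by norm_num) (by lia) (by linarith)
  obtain ⟨x, hx⟩ : ∃ x : ℤ, ((x : ℝ), ((2 : ℤ) : ℝ)) ∈ latticePts (interior (convexHull ℝ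
      ({((0:ℝ), (0:ℝ)), ((0:ℝ), (1:ℝ)),
        (((2 * g + 1 : ℤ) : ℝ), ((b : ℤ) : ℝ))} : Set (ℝ × ℝ)))) := by
    have hpos : 0 < b - 1 := by linarith
    have hlt := Int.lt_ediv_add_one_mul_self (2 * g + 1) hpos
    have hle := Int.ediv_mul_le (2 * g + 1) hpos.ne'
    have hq : 0 ≤ (2 * g + 1) / (b - 1) := Int.ediv_nonneg (by linarith) hpos.le
    generalize (2 * g + 1) / (b - 1) = q at hlt hle hq
    refine ⟨q + 1, key _ _ (by linarith) ?_ (by linarith)⟩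
    have hwidth : b * (b - 1) < (2 * g + 1) * (b - 2) := by nlinarith
    have hscaled : b * (q * (b - 1)) ≤ b * (2 * g + 1) :=
      mul_le_mul_of_nonneg_left hle (by linarith)
    refine lt_of_mul_lt_mul_right ?_ hpos.le
    linarith
  refine ⟨⟨_, _, ?_, h11, h21, by simp, by simp⟩, ⟨_, hx, by simp⟩, fun hcol => ?_⟩
  · simp
  · obtain ⟨v, hv⟩ := (collinear_iff_of_mem h11).1 hcol
    obtain ⟨r, hr⟩ := hv _ h21
    obtain ⟨s, hs⟩ := hv _ hx
    simp only [vadd_eq_add, Prod.ext_iff, Prod.fst_add, Prod.snd_add, Prod.smul_fst,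
      Prod.smul_snd, smul_eq_mul] at hr hs
    push_cast at hr hs
    have hr₁ : r * v.1 = 1 := by linarith [hr.1]
    have hr₂ : r * v.2 = 0 := by linarith [hr.2]
    have hs₂ : s * v.2 = 1 := by linarith [hs.2]
    rcases mul_eq_zero.1 hr₂ with h | h
    · simp [h] at hr₁
    · simp [h] at hs₂
end

section
/- Every lattice triangle with exactly three boundary lattice points and exactly 4 interior lattice points has all of its interior lattice points collinear. -/
/-- Twice the signed area of the triangle with vertices `a`, `b`, `c`. -/
def signedArea {R : Type*} [CommRing R] (a b c : R × R) : R :=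
  (b.1 - a.1) * (c.2 - a.2) - (b.2 - a.2) * (c.1 - a.1)

/-- The integer point `z` viewed as a point of the real plane. -/
def realPt (z : ℤ × ℤ) : ℝ × ℝ := ((z.1 : ℝ), (z.2 : ℝ))

theorem realPt_injective : Function.Injective realPt := by
  intro x y h
  simpa [realPt, Prod.ext_iff] using h

theorem signedArea_realPt (a b c : ℤ × ℤ) :
    signedArea (realPt a) (realPt b) (realPt c) = (signedArea a b c : ℤ) := by
  simp [signedArea, realPt]

theorem latticePts_eq_image (S : Set (ℝ × ℝ)) : latticePts S = realPt '' (realPt ⁻¹' S) := by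
  ext z
  constructor
  · rintro ⟨hz, m, n, rfl⟩
    exact ⟨(m, n), hz, rfl⟩
  · rintro ⟨w, hw, rfl⟩
    exact ⟨hw, w.1, w.2, rfl⟩

theorem collinear_of_linear_equation (S : Set (ℝ × ℝ)) (α β c : ℝ) (h : α ≠ 0 ∨ β ≠ 0)
    (hS : ∀ z ∈ S, α * z.1 + β * z.2 = c) : Collinear ℝ S := by
  rcases S.eq_empty_or_nonempty with rfl | ⟨z₀, hz₀⟩
  · exact collinear_empty ℝ _
  have hsq : 0 < α ^ 2 + β ^ 2 := by
    rcases h with h | h <;> positivity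
  rw [collinear_iff_of_mem hz₀]
  refine ⟨(-β, α), fun z hz => ⟨(α * (z.2 - z₀.2) - β * (z.1 - z₀.1)) / (α ^ 2 + β ^ 2), ?_⟩⟩
  have h₁ := hS z hz
  have h₀ := hS z₀ hz₀
  ext
  · simp only [vadd_eq_add, Prod.fst_add, Prod.smul_fst, smul_eq_mul]
    field_simp
    linear_combination α * (h₁ - h₀)
  · simp only [vadd_eq_add, Prod.snd_add, Prod.smul_snd, smul_eq_mul]
    field_simp
    linear_combination β * (h₁ - h₀)

theorem signedArea_ne_zero {p q r : ℝ × ℝ} (h : ¬ Collinear ℝ ({p, q, r} : Set (ℝ × ℝ))) :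
    signedArea p q r ≠ 0 := by
  intro h0
  have hpq : p ≠ q := by
    rintro rfl
    exact h (by simpa using collinear_pair ℝ p r)
  refine h (collinear_of_linear_equation _ (q.2 - p.2) (-(q.1 - p.1))
    ((q.2 - p.2) * p.1 - (q.1 - p.1) * p.2) ?_ ?_)
  · by_contra! hc
    exact hpq (Prod.ext (by linarith) (by linarith))
  · unfold signedArea at h0
    rintro z (rfl | rfl | rfl)
    · ring
    · ring
    · linarith

theorem mem_triangle_iff {p q r : ℝ × ℝ} (h : ¬ Collinear ℝ ({p, q, r} : Set (ℝ × ℝ)))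
    (hD : 0 < signedArea p q r) (z : ℝ × ℝ) :
    (z ∈ convexHull ℝ ({p, q, r} : Set (ℝ × ℝ)) ↔
      0 ≤ signedArea p q z ∧ 0 ≤ signedArea q r z ∧ 0 ≤ signedArea r p z) ∧
    (z ∈ interior (convexHull ℝ ({p, q, r} : Set (ℝ × ℝ))) ↔
      0 < signedArea p q z ∧ 0 < signedArea q r z ∧ 0 < signedArea r p z) := by
  have hind : AffineIndependent ℝ ![p, q, r] := affineIndependent_iff_not_collinear_set.2 h
  have htop : affineSpan ℝ (Set.range ![p, q, r]) = ⊤ := by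
    rw [hind.affineSpan_eq_top_iff_card_eq_finrank_add_one]
    simp
  let b : AffineBasis (Fin 3) ℝ (ℝ × ℝ) := ⟨![p, q, r], hind, htop⟩
  have hrange : ({p, q, r} : Set (ℝ × ℝ)) = Set.range b := by
    change _ = Set.range ![p, q, r]
    simp only [Matrix.range_cons, Matrix.range_empty, Set.insert_eq, Set.union_empty]
  have hsum : b.coord 0 z + b.coord 1 z + b.coord 2 z = 1 := by
    rw [← Fin.sum_univ_three (fun i => b.coord i z), b.sum_coord_apply_eq_one]
  have hcomb : b.coord 0 z • p + b.coord 1 z • q + b.coord 2 z • r = z := by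
    exact (Fin.sum_univ_three (fun i => b.coord i z • b i)).symm.trans
      (b.linear_combination_coord_eq_self z)
  have h1 := congrArg Prod.fst hcomb
  have h2 := congrArg Prod.snd hcomb
  simp only [Prod.fst_add, Prod.snd_add, Prod.smul_fst, Prod.smul_snd, smul_eq_mul] at h1 h2
  have hs : b.coord 0 z = 1 - b.coord 1 z - b.coord 2 z := by linarith
  have e2 : signedArea p q z = signedArea p q r * b.coord 2 z := by
    rw [hs] at h1 h2
    simp only [signedArea, ← h1, ← h2]; ring
  have e0 : signedArea q r z = signedArea p q r * b.coord 0 z := by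
    rw [hs] at h1 h2 ⊢
    simp only [signedArea, ← h1, ← h2]; ring
  have e1 : signedArea r p z = signedArea p q r * b.coord 1 z := by
    rw [hs] at h1 h2
    simp only [signedArea, ← h1, ← h2]; ring
  rw [hrange, b.interior_convexHull, b.convexHull_eq_nonneg_coord]
  simp only [Set.mem_ofPred_eq, Fin.forall_fin_succ, e0, e1, e2, mul_pos_iff_of_pos_left hD,
    mul_nonneg_iff_of_pos_left hD]
  simp only [Fin.succ_zero_eq_one, Fin.succ_one_eq_two, IsEmpty.forall_iff, and_true]
  tauto

/-- The edge vector `q - p` is primitive if every integer point of the triangle `p`, `q`, `r`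
lying on an edge is a vertex. -/
theorem isCoprime_edge {p q r : ℤ × ℤ} (hD : 0 < signedArea p q r)
    (H : ∀ z, signedArea p q z = 0 → 0 ≤ signedArea q r z → 0 ≤ signedArea r p z →
      z = p ∨ z = q ∨ z = r) : IsCoprime (q.1 - p.1) (q.2 - p.2) := by
  rw [Int.isCoprime_iff_gcd_eq_one]
  obtain ⟨u₁, h₁⟩ := Int.gcd_dvd_left (q.1 - p.1) (q.2 - p.2)
  obtain ⟨u₂, h₂⟩ := Int.gcd_dvd_right (q.1 - p.1) (q.2 - p.2)
  generalize hd : Int.gcd (q.1 - p.1) (q.2 - p.2) = d at h₁ h₂ ⊢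
  have key : (d : ℤ) * signedArea r p (p.1 + u₁, p.2 + u₂) = signedArea p q r := by
    simp only [signedArea, h₁, h₂]; ring
  have h0 : signedArea p q (p.1 + u₁, p.2 + u₂) = 0 := by
    simp only [signedArea, h₁, h₂]; ring
  have hsum : signedArea q r (p.1 + u₁, p.2 + u₂) + signedArea r p (p.1 + u₁, p.2 + u₂)
      + signedArea p q (p.1 + u₁, p.2 + u₂) = signedArea p q r := by
    simp only [signedArea]; ring
  have hpos : 0 < signedArea r p (p.1 + u₁, p.2 + u₂) :=
    pos_of_mul_pos_right (key ▸ hD) (Int.natCast_nonneg d)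
  have hd1 : (1 : ℤ) ≤ d := by
    rcases Nat.eq_zero_or_pos d with rfl | h
    · simp at key; omega
    · exact_mod_cast h
  have hle : 0 ≤ signedArea q r (p.1 + u₁, p.2 + u₂) := by nlinarith
  rcases H _ h0 hle hpos.le with h | h | h
  · rw [h] at hpos; simp [signedArea, mul_comm] at hpos
  · have : signedArea r p q = signedArea p q r := by simp only [signedArea]; ring
    rw [h, this] at key
    have := mul_right_cancel₀ hD.ne' (key.trans (one_mul _).symm)
    exact_mod_cast this
  · rw [h] at hpos; simp only [signedArea] at hpos; ring_nf at hpos; simp at hpos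

/-- The integers `y ∈ (0, D)` for which the representatives in `[0, D)` of `-a * y` and `y`
add up to less than `D` are half of all integers in `(0, D)`. -/
theorem two_mul_card_filter_add_lt {a D : ℤ} (ha : IsCoprime a D) (ha' : IsCoprime (a - 1) D) :
    2 * ((Finset.Ioo 0 D).filter (fun y => (-a * y) % D + y < D)).card = (D - 1).toNat := by
  have hsplit := Finset.card_filter_add_card_filter_not (s := Finset.Ioo 0 D)
    (fun y => (-a * y) % D + y < D)
  rw [Int.card_Ioo, sub_zero] at hsplit
  rw [← hsplit, two_mul]
  congr 1
  have hne {y : ℤ} (h0 : 0 < y) (hD : y < D) : ¬ D ∣ y := fun h => by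
    have := Int.le_of_dvd h0 h
    omega
  have hrefl {y : ℤ} (h0 : 0 < y) (hD : y < D) :
      (-a * (D - y)) % D = D - (-a * y) % D := by
    have hnd : (-a * y) % D ≠ 0 := fun h => by
      have hdvd : D ∣ a * y := by simpa using Int.dvd_of_emod_eq_zero h
      exact hne h0 hD (ha.symm.dvd_of_dvd_mul_left hdvd)
    have hb₁ := Int.emod_nonneg (-a * y) (b := D) (by omega)
    have hb₂ := Int.emod_lt_of_pos (-a * y) (b := D) (by omega)
    have hdiv := Int.emod_add_mul_ediv (-a * y) D
    rw [← Int.emod_eq_of_lt (a := D - (-a * y) % D) (b := D) (by omega) (by omega)]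
    apply Int.ModEq.symm
    apply (Int.modEq_iff_dvd).2
    exact ⟨-a - 1 - (-a * y) / D, by linear_combination hdiv⟩
  have hsum {y : ℤ} (h0 : 0 < y) (hD : y < D) : (-a * y) % D + y ≠ D := fun h => by
    have hdiv := Int.emod_add_mul_ediv (-a * y) D
    have hdvd : D ∣ (a - 1) * y := ⟨-(-a * y / D) - 1, by linear_combination hdiv - h⟩
    exact hne h0 hD (ha'.symm.dvd_of_dvd_mul_left hdvd)
  refine Finset.card_nbij' (fun y => D - y) (fun y => D - y) ?_ ?_ ?_ ?_
  · intro y hy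
    simp only [Finset.coe_filter, Finset.mem_Ioo, Set.mem_ofPred_eq] at hy ⊢
    have := hrefl hy.1.1 hy.1.2
    omega
  · intro y hy
    simp only [Finset.coe_filter, Finset.mem_Ioo, Set.mem_ofPred_eq] at hy ⊢
    have := hrefl hy.1.1 hy.1.2
    have := hsum hy.1.1 hy.1.2
    omega
  · intro y _; simp
  · intro y _; simp

theorem ncard_interior_of_coprime {a D : ℤ} (hD : 0 < D) (ha : IsCoprime a D)
    (ha' : IsCoprime (a - 1) D) :
    2 * {z : ℤ × ℤ | 0 < z.2 ∧ 0 < D * z.1 - a * z.2 ∧ D * z.1 - a * z.2 + z.2 < D}.ncard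
      = (D - 1).toNat := by
  rw [← two_mul_card_filter_add_lt ha ha', ← Set.ncard_coe_finset]
  congr 1
  have hemod {x y : ℤ} (h1 : 0 < D * x - a * y) (h2 : D * x - a * y < D) :
      (-a * y) % D = D * x - a * y := by
    rw [← Int.emod_eq_of_lt h1.le h2, show D * x - a * y = -a * y + D * x by ring]
    simp
  refine Set.ncard_congr (fun z _ => z.2) ?_ ?_ ?_
  · rintro ⟨x, y⟩ ⟨h0, h1, h2⟩
    simp only [Finset.coe_filter, Finset.mem_Ioo, Set.mem_ofPred_eq] at *
    have := hemod h1 (by omega)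
    omega
  · rintro ⟨x, y⟩ ⟨x', y'⟩ ⟨h0, h1, h2⟩ ⟨h0', h1', h2'⟩ (rfl : y = y')
    simp only at *
    have e := hemod h1 (by omega)
    have e' := hemod h1' (by omega)
    have : D * x = D * x' := by omega
    rw [mul_left_cancel₀ hD.ne' this]
  · intro y hy
    simp only [Finset.coe_filter, Finset.mem_Ioo, Set.mem_ofPred_eq] at hy
    have hdiv := Int.emod_add_mul_ediv (-a * y) D
    have hnn := Int.emod_nonneg (-a * y) hD.ne'
    have hnd : (-a * y) % D ≠ 0 := fun h => by
      have hdvd : D ∣ a * y := by simpa using Int.dvd_of_emod_eq_zero h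
      have := Int.le_of_dvd hy.1.1 (ha.symm.dvd_of_dvd_mul_left hdvd)
      omega
    have hval : D * (-((-a * y) / D)) - a * y = (-a * y) % D := by linear_combination -hdiv
    refine ⟨(-((-a * y) / D), y), ⟨hy.1.1, ?_, ?_⟩, rfl⟩
    · simp only [hval]; omega
    · simp only [hval]; omega

theorem exists_line_of_area_nine {a : ℤ} (ha : IsCoprime a 9) (ha' : IsCoprime (a - 1) 9) :
    ∃ α β c : ℤ, α ≠ 0 ∧ ∀ x y : ℤ, 0 < y → 0 < 9 * x - a * y → 9 * x - a * y + y < 9 →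
      α * x + β * y = c := by
  have hmod : a % 3 = 2 := by
    have h3 {b : ℤ} (hb : IsCoprime b 9) : ¬ (3 : ℤ) ∣ b := fun h => by
      have := hb.isUnit_of_dvd' h (by norm_num)
      rw [Int.isUnit_iff] at this
      omega
    have := h3 ha
    have := h3 ha'
    omega
  obtain ⟨k, hk⟩ : ∃ k, a = 9 * k + 2 ∨ a = 9 * k + 5 ∨ a = 9 * k + 8 := ⟨a / 9, by omega⟩
  have hshift (x y b : ℤ) : 9 * x - (9 * k + b) * y = 9 * (x - k * y) - b * y := by ring
  rcases hk with rfl | rfl | rfl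
  · refine ⟨1, -k, 1, by norm_num, fun x y h0 h1 h2 => ?_⟩
    rw [hshift] at h1 h2
    have : x - k * y = 1 := by omega
    linear_combination this
  · refine ⟨2, -2 * k - 1, 1, by norm_num, fun x y h0 h1 h2 => ?_⟩
    rw [hshift] at h1 h2
    have : y = 2 * (x - k * y) - 1 := by omega
    linear_combination -this
  · refine ⟨1, -k - 1, 0, by norm_num, fun x y h0 h1 h2 => ?_⟩
    rw [hshift] at h1 h2
    have : y = x - k * y := by omega
    linear_combination -this

/-- A positively oriented integer triangle whose only boundary points are its vertices and with
four interior points has all its interior points on a line. -/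
theorem exists_line_of_four_interior {p q r : ℤ × ℤ} (hD : 0 < signedArea p q r)
    (H : ∀ z, 0 ≤ signedArea p q z → 0 ≤ signedArea q r z → 0 ≤ signedArea r p z →
      ¬ (0 < signedArea p q z ∧ 0 < signedArea q r z ∧ 0 < signedArea r p z) →
      z = p ∨ z = q ∨ z = r)
    (hcard : {z | 0 < signedArea p q z ∧ 0 < signedArea q r z ∧ 0 < signedArea r p z}.ncard = 4) :
    ∃ α β c : ℤ, (α ≠ 0 ∨ β ≠ 0) ∧ ∀ z, 0 < signedArea p q z → 0 < signedArea q r z →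
      0 < signedArea r p z → α * z.1 + β * z.2 = c := by
  have hcyc : signedArea q r p = signedArea p q r := by simp only [signedArea]; ring
  have hcyc' : signedArea r p q = signedArea p q r := by simp only [signedArea]; ring
  obtain ⟨s, t, hu⟩ := isCoprime_edge hD fun z h0 h1 h2 => H z h0.ge h1 h2 (by omega)
  obtain ⟨s', t', hvu⟩ := isCoprime_edge (hcyc ▸ hD) fun z h0 h1 h2 => by
    have := H z h2 h0.ge h1 (by omega)
    tauto
  obtain ⟨s'', t'', hv⟩ := isCoprime_edge (hcyc' ▸ hD) fun z h0 h1 h2 => by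
    have := H z h1 h2 h0.ge (by omega)
    tauto
  set D := signedArea p q r with hDdef
  obtain ⟨a, ha⟩ : ∃ a, a = (r.1 - p.1) * s + (r.2 - p.2) * t := ⟨_, rfl⟩
  have hr1 : r.1 - p.1 = a * (q.1 - p.1) - D * t := by
    rw [hDdef, signedArea, ha]; linear_combination (-(r.1 - p.1)) * hu
  have hr2 : r.2 - p.2 = a * (q.2 - p.2) + D * s := by
    rw [hDdef, signedArea, ha]; linear_combination (-(r.2 - p.2)) * hu
  have hco : IsCoprime a D :=
    ⟨-(s'' * (q.1 - p.1) + t'' * (q.2 - p.2)), s'' * t - t'' * s, by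
      linear_combination hv + s'' * hr1 + t'' * hr2⟩
  have hco' : IsCoprime (a - 1) D :=
    ⟨s' * (q.1 - p.1) + t' * (q.2 - p.2), -s' * t + t' * s, by
      linear_combination hvu - s' * hr1 - t' * hr2⟩
  have hf (z : ℤ × ℤ) : signedArea r p z =
      D * (s * (z.1 - p.1) + t * (z.2 - p.2)) - a * signedArea p q z := by
    have : signedArea r p z = (z.1 - p.1) * (r.2 - p.2) - (z.2 - p.2) * (r.1 - p.1) := by
      simp only [signedArea]; ring
    rw [this, hr1, hr2]; simp only [signedArea]; ring
  have hsum (z : ℤ × ℤ) :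
      signedArea q r z = D - (signedArea r p z + signedArea p q z) := by
    simp only [hDdef, signedArea]; ring
  have hcount := ncard_interior_of_coprime hD hco hco'
  have hcongr : {z | 0 < signedArea p q z ∧ 0 < signedArea q r z ∧ 0 < signedArea r p z}.ncard =
      {z : ℤ × ℤ | 0 < z.2 ∧ 0 < D * z.1 - a * z.2 ∧ D * z.1 - a * z.2 + z.2 < D}.ncard := by
    refine Set.ncard_congr
      (fun z _ => (s * (z.1 - p.1) + t * (z.2 - p.2), signedArea p q z)) ?_ ?_ ?_
    · rintro z ⟨h0, h1, h2⟩
      rw [hsum] at h1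
      simp only [Set.mem_ofPred_eq, ← hf]
      omega
    · rintro z w - - h
      obtain ⟨h1, h2⟩ := Prod.ext_iff.1 h
      simp only [signedArea] at h1 h2
      ext
      · linear_combination (q.1 - p.1) * h1 - t * h2 - (z.1 - w.1) * hu
      · linear_combination (q.2 - p.2) * h1 + s * h2 - (z.2 - w.2) * hu
    · rintro ⟨x, y⟩ ⟨h0, h1, h2⟩
      have ex : s * (p.1 + x * (q.1 - p.1) - y * t - p.1)
          + t * (p.2 + x * (q.2 - p.2) + y * s - p.2) = x := by
        linear_combination x * hu
      have ey : signedArea p q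
          (p.1 + x * (q.1 - p.1) - y * t, p.2 + x * (q.2 - p.2) + y * s) = y := by
        simp only [signedArea]; linear_combination y * hu
      refine ⟨(p.1 + x * (q.1 - p.1) - y * t, p.2 + x * (q.2 - p.2) + y * s), ?_, ?_⟩
      · simp only [Set.mem_ofPred_eq, hsum, hf, ex, ey] at h0 h1 h2 ⊢
        omega
      · simp only [ex, ey]
  rw [← hcongr, hcard] at hcount
  have h9 : D = 9 := by omega
  rw [h9] at hco hco' hf hsum
  obtain ⟨α, β, c, hα, hline⟩ := exists_line_of_area_nine hco hco'
  refine ⟨α * s - β * (q.2 - p.2), α * t + β * (q.1 - p.1),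
    c + α * (s * p.1 + t * p.2) + β * ((q.1 - p.1) * p.2 - (q.2 - p.2) * p.1), ?_, ?_⟩
  · by_contra! hc
    apply hα
    linear_combination (q.1 - p.1) * hc.1 + (q.2 - p.2) * hc.2 - α * hu
  · intro z h0 h1 h2
    have h1' := hsum z
    have h2' := hf z
    have := hline (s * (z.1 - p.1) + t * (z.2 - p.2)) (signedArea p q z) h0
      (by rw [← h2']; exact h2) (by rw [← h2']; omega)
    simp only [signedArea] at this
    linear_combination this

theorem collinear_interior_of_signedArea_pos {p q r : ℤ × ℤ} (hD : 0 < signedArea p q r)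
    (hdim : ¬ Collinear ℝ ({realPt p, realPt q, realPt r} : Set (ℝ × ℝ)))
    (hbd : (latticePts (frontier
      (convexHull ℝ ({realPt p, realPt q, realPt r} : Set (ℝ × ℝ))))).ncard = 3)
    (hint : (latticePts (interior
      (convexHull ℝ ({realPt p, realPt q, realPt r} : Set (ℝ × ℝ))))).ncard = 4) :
    Collinear ℝ (latticePts (interior
      (convexHull ℝ ({realPt p, realPt q, realPt r} : Set (ℝ × ℝ))))) := by
  have hmem := mem_triangle_iff hdim (by rw [signedArea_realPt]; exact_mod_cast hD)
  have hclosed : IsClosed (convexHull ℝ ({realPt p, realPt q, realPt r} : Set (ℝ × ℝ))) :=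
    (Set.toFinite _).isClosed_convexHull (𝕜 := ℝ)
  set T := convexHull ℝ ({realPt p, realPt q, realPt r} : Set (ℝ × ℝ))
  have hT (z : ℤ × ℤ) : realPt z ∈ T ↔
      0 ≤ signedArea p q z ∧ 0 ≤ signedArea q r z ∧ 0 ≤ signedArea r p z := by
    simpa only [signedArea_realPt, Int.cast_nonneg_iff] using (hmem (realPt z)).1
  have hI (z : ℤ × ℤ) : realPt z ∈ interior T ↔
      0 < signedArea p q z ∧ 0 < signedArea q r z ∧ 0 < signedArea r p z := by
    simpa only [signedArea_realPt, Int.cast_pos] using (hmem (realPt z)).2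
  have hF (z : ℤ × ℤ) : z ∈ realPt ⁻¹' frontier T ↔
      (0 ≤ signedArea p q z ∧ 0 ≤ signedArea q r z ∧ 0 ≤ signedArea r p z) ∧
      ¬ (0 < signedArea p q z ∧ 0 < signedArea q r z ∧ 0 < signedArea r p z) := by
    rw [Set.mem_preimage, hclosed.frontier_eq, Set.mem_sdiff, hT, hI]
  rw [latticePts_eq_image, Set.ncard_image_of_injective _ realPt_injective] at hbd hint
  have hsub : ({p, q, r} : Set (ℤ × ℤ)) ⊆ realPt ⁻¹' frontier T := by
    have hp : signedArea p q p = 0 ∧ signedArea q r p = signedArea p q r ∧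
        signedArea r p p = 0 := by refine ⟨?_, ?_, ?_⟩ <;> simp only [signedArea] <;> ring
    have hq : signedArea p q q = 0 ∧ signedArea q r q = 0 ∧
        signedArea r p q = signedArea p q r := by
      refine ⟨?_, ?_, ?_⟩ <;> simp only [signedArea] <;> ring
    have hr : signedArea q r r = 0 ∧ signedArea r p r = 0 := by
      refine ⟨?_, ?_⟩ <;> simp only [signedArea] <;> ring
    rintro z (rfl | rfl | rfl) <;> rw [hF] <;> omega
  have hpq : p ≠ q := by rintro rfl; simp [signedArea] at hD
  have hpr : p ≠ r := by rintro rfl; simp [signedArea] at hD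
  have hqr : q ≠ r := by rintro rfl; simp [signedArea, mul_comm] at hD
  have hvert : ({p, q, r} : Set (ℤ × ℤ)) = realPt ⁻¹' frontier T :=
    Set.eq_of_subset_of_ncard_le hsub
      (by rw [hbd, Set.ncard_eq_three.2 ⟨p, q, r, hpq, hpr, hqr, rfl⟩])
      (Set.finite_of_ncard_ne_zero (by omega))
  obtain ⟨α, β, c, hne, hline⟩ := exists_line_of_four_interior hD
    (fun z h0 h1 h2 h3 => by
      have : z ∈ realPt ⁻¹' frontier T := (hF z).2 ⟨⟨h0, h1, h2⟩, h3⟩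
      rw [← hvert] at this
      simpa using this)
    (by rw [← hint]; congr 1; ext z; exact (hI z).symm)
  refine collinear_of_linear_equation _ α β c (by exact_mod_cast hne) ?_
  rw [latticePts_eq_image]
  rintro _ ⟨z, hz, rfl⟩
  obtain ⟨h0, h1, h2⟩ := (hI z).1 hz
  simp only [realPt]
  exact_mod_cast hline z h0 h1 h2

/-- Every lattice triangle with exactly three boundary lattice points and exactly `4`
interior lattice points has all of its interior lattice points collinear. -/
theorem stmt8 (p q r : ℝ × ℝ) (hp : LatticePt p) (hq : LatticePt q) (hr : LatticePt r)
    (hdim : ¬ Collinear ℝ ({p, q, r} : Set (ℝ × ℝ)))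
    (T : Set (ℝ × ℝ)) (hT : T = convexHull ℝ ({p, q, r} : Set (ℝ × ℝ)))
    (hbd : (latticePts (frontier T)).ncard = 3)
    (hint : (latticePts (interior T)).ncard = 4) :
    Collinear ℝ (latticePts (interior T)) := by
  obtain ⟨p₁, p₂, hp⟩ := hp
  obtain ⟨q₁, q₂, hq⟩ := hq
  obtain ⟨r₁, r₂, hr⟩ := hr
  obtain rfl : p = realPt (p₁, p₂) := hp
  obtain rfl : q = realPt (q₁, q₂) := hq
  obtain rfl : r = realPt (r₁, r₂) := hr
  subst hT
  have h0 := signedArea_ne_zero hdim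
  rw [signedArea_realPt, Int.cast_ne_zero] at h0
  rcases h0.lt_or_gt with h | h
  · rw [Set.pair_comm (realPt (q₁, q₂))] at *
    refine collinear_interior_of_signedArea_pos ?_ hdim hbd hint
    simp only [signedArea] at h ⊢
    linarith
  · exact collinear_interior_of_signedArea_pos h hdim hbd hint
end

section
/- Let a and b be integers with 0 ≤ a ≤ b, b ≥ 1, and 2a ≥ b − 2. Then the set {(x,y) ∈ ℝ² : x ≥ −1, −1 ≤ y ≤ 2, and x + (b−a)y ≤ b+1} equals the convex hull of the four points (−1,−1), (−1,2), (2b−a+1,−1), and (2a−b+1,2). -/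
/-- For integers `0 ≤ a ≤ b` with `b ≥ 1` and `2a ≥ b - 2`, the polyhedron
`{(x,y) : x ≥ -1, -1 ≤ y ≤ 2, x + (b-a)y ≤ b+1}` equals the convex hull of
`(-1,-1)`, `(-1,2)`, `(2b-a+1,-1)`, and `(2a-b+1,2)`. -/
theorem stmt10 (a b : ℤ) (ha : 0 ≤ a) (hab : a ≤ b) (hb : 1 ≤ b) (h2 : b - 2 ≤ 2 * a) :
    {p : ℝ × ℝ | -1 ≤ p.1 ∧ -1 ≤ p.2 ∧ p.2 ≤ 2 ∧
        p.1 + ((b : ℝ) - (a : ℝ)) * p.2 ≤ (b : ℝ) + 1} =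
      convexHull ℝ ({((-1:ℝ), (-1:ℝ)), ((-1:ℝ), (2:ℝ)),
        (((2 * b - a + 1 : ℤ) : ℝ), (-1:ℝ)),
        (((2 * a - b + 1 : ℤ) : ℝ), (2:ℝ))} : Set (ℝ × ℝ)) := by
  have hab' : (a : ℝ) ≤ b := by exact_mod_cast hab
  have h2' : (b : ℝ) - 2 ≤ 2 * a := by exact_mod_cast h2
  push_cast
  apply Set.Subset.antisymm
  · rintro ⟨x, y⟩ ⟨hx, hy, hy', hxy⟩
    dsimp only at hx hy hy' hxy
    set S : Set (ℝ × ℝ) := {((-1:ℝ), (-1:ℝ)), ((-1:ℝ), (2:ℝ)),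
      (2 * (b : ℝ) - a + 1, (-1:ℝ)), (2 * (a : ℝ) - b + 1, (2:ℝ))} with hS
    have hconv : Convex ℝ (convexHull ℝ S) := convex_convexHull ℝ S
    have hvert : ∀ p ∈ S, p ∈ convexHull ℝ S := fun p hp => subset_convexHull ℝ S hp
    have hleft : ((-1 : ℝ), y) ∈ convexHull ℝ S := by
      have h := hconv (hvert (-1, -1) (by simp [hS])) (hvert (-1, 2) (by simp [hS]))
        (show 0 ≤ (2 - y) / 3 by linarith) (show 0 ≤ (y + 1) / 3 by linarith) (by ring)
      convert h using 1
      ext <;> simp <;> ring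
    have hright : ((b : ℝ) + 1 - (b - a) * y, y) ∈ convexHull ℝ S := by
      have h := hconv (hvert (2 * (b : ℝ) - a + 1, -1) (by simp [hS]))
        (hvert (2 * (a : ℝ) - b + 1, 2) (by simp [hS]))
        (show 0 ≤ (2 - y) / 3 by linarith) (show 0 ≤ (y + 1) / 3 by linarith) (by ring)
      convert h using 1
      ext <;> simp <;> ring
    rcases eq_or_lt_of_le hx with rfl | hx
    · exact hleft
    · have hpos : 0 < (b : ℝ) + 2 - (b - a) * y := by linarith
      have h := hconv hleft hright
        (show 0 ≤ ((b : ℝ) + 1 - (b - a) * y - x) / (b + 2 - (b - a) * y) from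
          div_nonneg (by linarith) hpos.le)
        (show 0 ≤ (x + 1) / ((b : ℝ) + 2 - (b - a) * y) from
          div_nonneg (by linarith) hpos.le)
        (by rw [← add_div, div_eq_one_iff_eq hpos.ne']; ring)
      convert h using 1
      ext <;> simp only [Prod.fst_add, Prod.snd_add, Prod.smul_fst, Prod.smul_snd, smul_eq_mul] <;>
        (have hne := hpos.ne'; generalize hR : (b : ℝ) + 2 - (b - a) * y = R at hne ⊢
         field_simp; subst hR; ring)
  · apply convexHull_min
    · rintro p (rfl | rfl | rfl | rfl) <;> refine ⟨?_, ?_, ?_, ?_⟩ <;> dsimp only <;> linarith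
    · rintro ⟨x, y⟩ ⟨h₁, h₂, h₃, h₄⟩ ⟨u, v⟩ ⟨k₁, k₂, k₃, k₄⟩ s t hs ht hst
      dsimp only at h₁ h₂ h₃ h₄ k₁ k₂ k₃ k₄
      obtain rfl : s = 1 - t := by linarith
      refine ⟨?_, ?_, ?_, ?_⟩ <;>
        simp only [Prod.fst_add, Prod.snd_add, Prod.smul_fst, Prod.smul_snd, smul_eq_mul]
      · linarith [mul_le_mul_of_nonneg_left h₁ hs, mul_le_mul_of_nonneg_left k₁ ht]
      · linarith [mul_le_mul_of_nonneg_left h₂ hs, mul_le_mul_of_nonneg_left k₂ ht]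
      · linarith [mul_le_mul_of_nonneg_left h₃ hs, mul_le_mul_of_nonneg_left k₃ ht]
      · linarith [mul_le_mul_of_nonneg_left h₄ hs, mul_le_mul_of_nonneg_left k₄ ht]
end

section
/- Let a and b be integers with 0 ≤ a ≤ b, b ≥ 1, and 2a ≥ b − 2, and let Q be the convex hull of (−1,−1), (−1,2), (2b−a+1,−1), and (2a−b+1,2). Then the lattice points in the topological interior of Q are exactly the lattice points of the trapezoid conv{(0,0), (0,1), (b,0), (a,1)}; in particular, Q has exactly a + b + 2 interior lattice points. -/
/-- A trapezoid with two horizontal sides and a vertical left side is cut out by four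
linear inequalities. -/
theorem mem_convexHull_trapezoid {x₀ y₀ y₁ c d : ℝ} (hy : y₀ < y₁)
    (h₀ : x₀ ≤ c + d * y₀) (h₁ : x₀ ≤ c + d * y₁) (p : ℝ × ℝ) :
    p ∈ convexHull ℝ ({(x₀, y₀), (x₀, y₁), (c + d * y₀, y₀), (c + d * y₁, y₁)} :
      Set (ℝ × ℝ)) ↔
    x₀ ≤ p.1 ∧ p.1 ≤ c + d * p.2 ∧ y₀ ≤ p.2 ∧ p.2 ≤ y₁ := by
  constructor
  · intro hp
    refine convexHull_min (t := {p : ℝ × ℝ |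
      x₀ ≤ p.1 ∧ p.1 ≤ c + d * p.2 ∧ y₀ ≤ p.2 ∧ p.2 ≤ y₁}) ?_ ?_ hp
    · rintro q (rfl | rfl | rfl | rfl) <;> simp [h₀, h₁, hy.le]
    · rintro u ⟨hu₁, hu₂, hu₃, hu₄⟩ v ⟨hv₁, hv₂, hv₃, hv₄⟩ s t hs ht hst
      obtain rfl : t = 1 - s := by linarith
      simp only [Set.mem_ofPred_eq, Prod.fst_add, Prod.snd_add, Prod.smul_fst, Prod.smul_snd,
        smul_eq_mul]
      refine ⟨?_, ?_, ?_, ?_⟩ <;> nlinarith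
  · obtain ⟨x, y⟩ := p
    rintro ⟨hx₀, hx, hy₀, hy₁⟩
    dsimp only at hx₀ hx hy₀ hy₁
    set K : Set (ℝ × ℝ) := {(x₀, y₀), (x₀, y₁), (c + d * y₀, y₀), (c + d * y₁, y₁)} with hK
    have hconv : Convex ℝ (convexHull ℝ K) := convex_convexHull ℝ K
    have hsub := subset_convexHull ℝ K
    have hpos : 0 < y₁ - y₀ := sub_pos.2 hy
    have hs : 0 ≤ (y₁ - y) / (y₁ - y₀) := div_nonneg (by linarith) hpos.le
    have ht : 0 ≤ (y - y₀) / (y₁ - y₀) := div_nonneg (by linarith) hpos.le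
    have hst : (y₁ - y) / (y₁ - y₀) + (y - y₀) / (y₁ - y₀) = 1 := by
      field_simp
      ring
    have hleft : (x₀, y) ∈ convexHull ℝ K := by
      convert hconv (hsub (show (x₀, y₀) ∈ K by simp [hK]))
        (hsub (show (x₀, y₁) ∈ K by simp [hK])) hs ht hst using 1
      ext <;> simp <;> field_simp <;> ring
    have hright : (c + d * y, y) ∈ convexHull ℝ K := by
      convert hconv (hsub (show (c + d * y₀, y₀) ∈ K by simp [hK]))
        (hsub (show (c + d * y₁, y₁) ∈ K by simp [hK])) hs ht hst using 1
      ext <;> simp <;> field_simp <;> ring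
    rcases (hx₀.trans hx).eq_or_lt with h | h
    · obtain rfl : x = x₀ := by linarith
      exact hleft
    · have hpos' : 0 < c + d * y - x₀ := sub_pos.2 h
      convert hconv hleft hright
        (div_nonneg (by linarith) hpos'.le : 0 ≤ (c + d * y - x) / (c + d * y - x₀))
        (div_nonneg (by linarith) hpos'.le : 0 ≤ (x - x₀) / (c + d * y - x₀))
        (by field_simp; ring) using 1
      ext
      · simp
        field_simp
        ring
      · simp only [Prod.snd_add, Prod.smul_snd, smul_eq_mul]
        rw [← add_mul, ← add_div, sub_add_sub_cancel, div_self hpos'.ne', one_mul]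

/-- The interior of a trapezoid is given by the strict versions of its four inequalities. -/
theorem mem_interior_convexHull_trapezoid {x₀ y₀ y₁ c d : ℝ} (hy : y₀ < y₁)
    (h₀ : x₀ ≤ c + d * y₀) (h₁ : x₀ ≤ c + d * y₁) (p : ℝ × ℝ) :
    p ∈ interior (convexHull ℝ
      ({(x₀, y₀), (x₀, y₁), (c + d * y₀, y₀), (c + d * y₁, y₁)} : Set (ℝ × ℝ))) ↔
    x₀ < p.1 ∧ p.1 < c + d * p.2 ∧ y₀ < p.2 ∧ p.2 < y₁ := by
  constructor
  · intro hp
    obtain ⟨ε, hε, hball⟩ := Metric.mem_nhds_iff.1 (mem_interior_iff_mem_nhds.1 hp)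
    have key : ∀ u v : ℝ, |u| < ε → |v| < ε →
        x₀ ≤ p.1 + u ∧ p.1 + u ≤ c + d * (p.2 + v) ∧ y₀ ≤ p.2 + v ∧ p.2 + v ≤ y₁ := by
      intro u v hu hv
      refine (mem_convexHull_trapezoid hy h₀ h₁ (p.1 + u, p.2 + v)).1 (hball ?_)
      simp [Prod.dist_eq, hu, hv]
    have hz : |(0 : ℝ)| < ε := by simpa using hε
    have hp' : |ε / 2| < ε := by rw [abs_of_pos (by linarith)]; linarith
    have hm' : |-(ε / 2)| < ε := by rwa [abs_neg]
    have e₁ := key _ _ hp' hz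
    have e₂ := key _ _ hm' hz
    have e₃ := key _ _ hz hp'
    have e₄ := key _ _ hz hm'
    rw [add_zero] at e₁ e₂
    exact ⟨by linarith [e₂.1], by linarith [e₁.2.1], by linarith [e₄.2.2.1],
      by linarith [e₃.2.2.2]⟩
  · intro hp
    refine mem_interior.2 ⟨{q | x₀ < q.1 ∧ q.1 < c + d * q.2 ∧ y₀ < q.2 ∧ q.2 < y₁}, ?_, ?_, hp⟩
    · rintro q ⟨k₁, k₂, k₃, k₄⟩
      exact (mem_convexHull_trapezoid hy h₀ h₁ q).2 ⟨k₁.le, k₂.le, k₃.le, k₄.le⟩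
    · refine IsOpen.and (isOpen_lt ?_ ?_) (IsOpen.and (isOpen_lt ?_ ?_)
        (IsOpen.and (isOpen_lt ?_ ?_) (isOpen_lt ?_ ?_))) <;> fun_prop

/-- The lattice points of the trapezoid with vertices `(0,0)`, `(0,1)`, `(b,0)`, `(a,1)`,
listed in its two rows. -/
noncomputable def trapezoidFinset (a b : ℤ) : Finset (ℤ × ℤ) :=
  Finset.Icc 0 b ×ˢ {0} ∪ Finset.Icc 0 a ×ˢ {1}

theorem mem_trapezoidFinset {a b m n : ℤ} :
    (m, n) ∈ trapezoidFinset a b ↔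
      (0 ≤ m ∧ m ≤ b) ∧ n = 0 ∨ (0 ≤ m ∧ m ≤ a) ∧ n = 1 := by
  simp [trapezoidFinset, eq_comm]

theorem card_trapezoidFinset {a b : ℤ} (ha : 0 ≤ a) (hb : 0 ≤ b) :
    ((trapezoidFinset a b).card : ℤ) = a + b + 2 := by
  rw [trapezoidFinset, Finset.card_union_of_disjoint]
  · simp only [Finset.card_product, Int.card_Icc, Finset.card_singleton]
    omega
  · rw [Finset.disjoint_left]
    rintro ⟨m, n⟩ h h'
    simp only [Finset.mem_product, Finset.mem_singleton] at h h'
    omega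

/-- A set of plane points is determined on lattice points by integer coordinates. -/
theorem latticePts_eq_image_s11 {S : Set (ℝ × ℝ)} {F : Finset (ℤ × ℤ)}
    (h : ∀ m n : ℤ, ((m : ℝ), (n : ℝ)) ∈ S ↔ (m, n) ∈ F) :
    latticePts S = Prod.map ((↑) : ℤ → ℝ) ((↑) : ℤ → ℝ) '' (F : Set (ℤ × ℤ)) := by
  ext p
  constructor
  · rintro ⟨hp, m, n, rfl⟩
    exact ⟨(m, n), (h m n).1 hp, rfl⟩
  · rintro ⟨⟨m, n⟩, hmn, rfl⟩
    exact ⟨(h m n).2 hmn, m, n, rfl⟩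

/-- For integers `0 ≤ a ≤ b` with `b ≥ 1` and `2a ≥ b - 2`, the lattice points in the
topological interior of `Q = conv{(-1,-1), (-1,2), (2b-a+1,-1), (2a-b+1,2)}` are
exactly the lattice points of the trapezoid `conv{(0,0), (0,1), (b,0), (a,1)}`;
in particular `Q` has exactly `a + b + 2` interior lattice points. -/
theorem stmt11 (a b : ℤ) (ha : 0 ≤ a) (hab : a ≤ b) (hb : 1 ≤ b) (h2 : b - 2 ≤ 2 * a)
    (Q : Set (ℝ × ℝ))
    (hQ : Q = convexHull ℝ ({((-1:ℝ), (-1:ℝ)), ((-1:ℝ), (2:ℝ)),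
      (((2 * b - a + 1 : ℤ) : ℝ), (-1:ℝ)),
      (((2 * a - b + 1 : ℤ) : ℝ), (2:ℝ))} : Set (ℝ × ℝ)))
    (T : Set (ℝ × ℝ))
    (hT : T = convexHull ℝ ({((0:ℝ), (0:ℝ)), ((0:ℝ), (1:ℝ)),
      (((b : ℤ) : ℝ), (0:ℝ)), (((a : ℤ) : ℝ), (1:ℝ))} : Set (ℝ × ℝ))) :
    latticePts (interior Q) = latticePts T ∧
    ((latticePts (interior Q)).ncard : ℤ) = a + b + 2 := by
  have hab' : (a : ℝ) ≤ b := by exact_mod_cast hab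
  have ha' : (0 : ℝ) ≤ a := by exact_mod_cast ha
  have hb' : (1 : ℝ) ≤ b := by exact_mod_cast hb
  have h2' : (b : ℝ) - 2 ≤ 2 * a := by exact_mod_cast h2
  have hQ' : Q = convexHull ℝ ({((-1 : ℝ), (-1 : ℝ)), ((-1 : ℝ), (2 : ℝ)),
      ((b + 1 : ℝ) + (a - b) * (-1), (-1 : ℝ)), ((b + 1 : ℝ) + (a - b) * 2, (2 : ℝ))} :
      Set (ℝ × ℝ)) := by
    rw [hQ]
    push_cast
    ring_nf
  have hT' : T = convexHull ℝ ({((0 : ℝ), (0 : ℝ)), ((0 : ℝ), (1 : ℝ)),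
      ((b : ℝ) + (a - b) * 0, (0 : ℝ)), ((b : ℝ) + (a - b) * 1, (1 : ℝ))} :
      Set (ℝ × ℝ)) := by
    rw [hT]
    ring_nf
  have hQF : latticePts (interior Q) = _ := latticePts_eq_image_s11 (F := trapezoidFinset a b) <| by
    intro m n
    rw [hQ', mem_interior_convexHull_trapezoid (by norm_num) (by linarith) (by linarith),
      mem_trapezoidFinset]
    dsimp only
    norm_cast
    constructor
    · rintro ⟨hm, hmn, hn, hn'⟩
      obtain rfl | rfl : n = 0 ∨ n = 1 := by omega
      all_goals omega
    · rintro (⟨hm, rfl⟩ | ⟨hm, rfl⟩) <;> omega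
  have hTF : latticePts T = _ := latticePts_eq_image_s11 (F := trapezoidFinset a b) <| by
    intro m n
    rw [hT', mem_convexHull_trapezoid (by norm_num) (by linarith) (by linarith),
      mem_trapezoidFinset]
    dsimp only
    norm_cast
    constructor
    · rintro ⟨hm, hmn, hn, hn'⟩
      obtain rfl | rfl : n = 0 ∨ n = 1 := by omega
      all_goals omega
    · rintro (⟨hm, rfl⟩ | ⟨hm, rfl⟩) <;> omega
  refine ⟨hQF.trans hTF.symm, ?_⟩
  rw [hQF, Set.ncard_image_of_injective _ (Int.cast_injective.prodMap Int.cast_injective),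
    Set.ncard_coe_finset, card_trapezoidFinset ha (by omega)]
end
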